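/- arXiv:1011.3661 — 6 statements merged into one kernel-verified Lean document; each statement's English description precedes it below -/
import Mathlib

section
/- Let G be a finite connected simple graph, let S be a spanning tree of G, and let e_0, e_1, …, e_k (k ≥ 1) be the successive edges of a path in G every interior vertex of which has degree exactly 2 in G. Then at most one of the edges e_0, …, e_k does not belong to S. -/
/-- A set of edges `S` is (the edge set of) a spanning tree of `G`:
a spanning subgraph, identified with its edge set, that is connected and acyclic. -/
def IsSpanningTree {V : Type*} (G : SimpleGraph V) (S : Set (Sym2 V)) : Prop :=
  S ⊆ G.edgeSet ∧ (SimpleGraph.fromEdgeSet S).IsTree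

/-- A vertex of degree `2` has no neighbours besides two given distinct ones. -/
theorem SimpleGraph.eq_or_eq_of_degree_eq_two {V : Type*} [Fintype V] [DecidableEq V]
    {G : SimpleGraph V} [DecidableRel G.Adj] {u x y w : V} (hu : G.degree u = 2)
    (hx : G.Adj u x) (hy : G.Adj u y) (hxy : x ≠ y) (hw : G.Adj u w) : w = x ∨ w = y := by
  have hsub : ({x, y} : Finset V) ⊆ G.neighborFinset u := by
    intro z hz
    rcases Finset.mem_insert.1 hz with rfl | hz
    · simpa using hx
    · rw [Finset.mem_singleton.1 hz]
      simpa using hy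
  have heq : ({x, y} : Finset V) = G.neighborFinset u :=
    Finset.eq_of_subset_of_card_le hsub (by
      rw [Finset.card_pair hxy, SimpleGraph.card_neighborFinset_eq_degree, hu])
  have hmem : w ∈ ({x, y} : Finset V) := by
    rw [heq]
    simpa using hw
  simpa using hmem

/-- Two different edges of a path whose interior vertices have degree `2` cannot both be missing
from a connected spanning subgraph: the segment between them would be cut off from `a`. -/
theorem SimpleGraph.Walk.IsPath.mem_of_lt_of_notMem {V : Type*} [Fintype V] [DecidableEq V]
    {G : SimpleGraph V} [DecidableRel G.Adj] {S : Set (Sym2 V)} (hSG : S ⊆ G.edgeSet)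
    (hS : (SimpleGraph.fromEdgeSet S).Connected) {a b : V} {p : G.Walk a b} (hp : p.IsPath)
    (hdeg : ∀ v ∈ p.support, v ≠ a → v ≠ b → G.degree v = 2) {i j : ℕ} (hij : i < j)
    (hj : j < p.length) (hi : s(p.getVert i, p.getVert (i + 1)) ∉ S) :
    s(p.getVert j, p.getVert (j + 1)) ∈ S := by
  by_contra hjS
  have hinj : ∀ m n, m ≤ p.length → n ≤ p.length → p.getVert m = p.getVert n → m = n :=
    fun m n hm hn h => hp.getVert_injOn hm hn h
  let A : Set V := {v | ∃ t, i < t ∧ t ≤ j ∧ p.getVert t = v}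
  have haA : a ∉ A := by
    rintro ⟨t, hit, htj, ht⟩
    have := hinj t 0 (by omega) (by omega) (by simpa using ht)
    omega
  obtain ⟨q⟩ := hS.preconnected (p.getVert (i + 1)) a
  obtain ⟨d, -, ⟨t, hit, htj, ht⟩, hdA⟩ :=
    q.exists_boundary_dart A ⟨i + 1, by omega, by omega, rfl⟩ haA
  have hdS : s(d.fst, d.snd) ∈ S := ((SimpleGraph.fromEdgeSet_adj S).1 d.adj).1
  have hadj : G.Adj d.fst d.snd := hSG hdS
  rw [← ht] at hdS hadj
  obtain ⟨n, rfl⟩ : ∃ n, t = n + 1 := ⟨t - 1, by omega⟩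
  have hdeg2 : G.degree (p.getVert (n + 1)) = 2 := by
    refine hdeg _ (p.getVert_mem_support _) (fun h => ?_) (fun h => ?_)
    · have := hinj (n + 1) 0 (by omega) (by omega) (by simpa using h)
      omega
    · have := hinj (n + 1) p.length (by omega) le_rfl (by simpa using h)
      omega
  have hne : p.getVert n ≠ p.getVert (n + 1 + 1) := fun h => by
    have := hinj n (n + 1 + 1) (by omega) (by omega) h
    omega
  rcases SimpleGraph.eq_or_eq_of_degree_eq_two hdeg2
    (p.adj_getVert_succ (i := n) (by omega)).symm
    (p.adj_getVert_succ (i := n + 1) (by omega)) hne hadj with h | h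
  · rw [h] at hdS
    by_cases hn : n = i
    · subst hn
      exact hi (by rwa [Sym2.eq_swap])
    · exact hdA ⟨n, by omega, by omega, h.symm⟩
  · rw [h] at hdS
    by_cases hn : n + 1 = j
    · subst hn
      exact hjS hdS
    · exact hdA ⟨n + 1 + 1, by omega, by omega, h.symm⟩

/-- If `e 0, …, e k` (`k ≥ 1`) are the successive edges of a path in a
finite connected simple graph `G` all of whose interior vertices have degree exactly `2`
in `G`, and `S` is a spanning tree of `G`, then at most one of these edges is outside `S`. -/
theorem at_most_one_edge_of_two_path_outside_spanning_tree
    {V : Type*} [Fintype V] [DecidableEq V]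
    (G : SimpleGraph V) [DecidableRel G.Adj] (hG : G.Connected)
    (S : Set (Sym2 V)) (hS : IsSpanningTree G S)
    (k : ℕ) (hk : 1 ≤ k) {a b : V} (p : G.Walk a b) (hp : p.IsPath)
    (e : Fin (k + 1) → Sym2 V) (he : p.edges = List.ofFn e)
    (hdeg : ∀ v ∈ p.support, v ≠ a → v ≠ b → G.degree v = 2) :
    ∀ i j : Fin (k + 1), e i ∉ S → e j ∉ S → i = j := by
  have hlen : p.length = k + 1 := by
    rw [← SimpleGraph.Walk.length_edges, he, List.length_ofFn]
  have hedge : ∀ i : Fin (k + 1), e i = s(p.getVert i, p.getVert (i + 1)) := by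
    intro i
    rw [← SimpleGraph.Walk.getElem_edges (by rw [p.length_edges]; omega)]
    simp only [he, List.getElem_ofFn]
  have hlt : ∀ i j : Fin (k + 1), e i ∉ S → e j ∉ S → ¬ i < j := by
    intro i j hi hj hij
    rw [hedge] at hi hj
    exact hj (hp.mem_of_lt_of_notMem hS.1 hS.2.connected hdeg hij (by omega) hi)
  intro i j hi hj
  exact le_antisymm (not_lt.1 (hlt j i hj hi)) (not_lt.1 (hlt i j hi hj))
end

section
/- Let G be a finite connected simple graph whose edge set carries a linear order, let e_0, e_1, …, e_k (k ≥ 1) be an ordered-consecutive 2-path in G, and let S be a spanning tree of G that contains the edges e_1, …, e_k but does not contain e_0. Then every edge e_m with 1 ≤ m ≤ k is internally inactive with respect to S. -/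
/-- An edge `e` of a spanning tree `S` is internally active if it is the minimum,
in the edge order, of the set of edges `f` of `G` such that `(S \ {e}) ∪ {f}` is again
a spanning tree of `G` (the fundamental cut of `e`). -/
def InternallyActive {V : Type*} [LinearOrder (Sym2 V)] (G : SimpleGraph V)
    (S : Set (Sym2 V)) (e : Sym2 V) : Prop :=
  e ∈ S ∧ ∀ f ∈ G.edgeSet, IsSpanningTree G (insert f (S \ {e})) → e ≤ f

/-- An edge of the spanning tree that is not internally active is internally inactive. -/
def InternallyInactive {V : Type*} [LinearOrder (Sym2 V)] (G : SimpleGraph V)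
    (S : Set (Sym2 V)) (e : Sym2 V) : Prop :=
  e ∈ S ∧ ¬ InternallyActive G S e

/-- An edge `e ∉ S` of `G` is externally active if it is the minimum edge of the unique
cycle contained in `S ∪ {e}` (the fundamental cycle of `e`). -/
def ExternallyActive {V : Type*} [LinearOrder (Sym2 V)] (G : SimpleGraph V)
    (S : Set (Sym2 V)) (e : Sym2 V) : Prop :=
  e ∈ G.edgeSet ∧ e ∉ S ∧
    ∀ (v : V) (c : (SimpleGraph.fromEdgeSet (insert e S)).Walk v v),
      c.IsCycle → ∀ f ∈ c.edges, e ≤ f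

/-- An edge of `G` outside the spanning tree that is not externally active is
externally inactive. -/
def ExternallyInactive {V : Type*} [LinearOrder (Sym2 V)] (G : SimpleGraph V)
    (S : Set (Sym2 V)) (e : Sym2 V) : Prop :=
  e ∈ G.edgeSet ∧ e ∉ S ∧ ¬ ExternallyActive G S e

open SimpleGraph

/-- A set of vertices closed under adjacency is closed under reachability. -/
theorem SimpleGraph.Reachable.mem_of_closed {V : Type*} {H : SimpleGraph V} {X : Set V}
    (hX : ∀ v ∈ X, ∀ w, H.Adj v w → w ∈ X) {v w : V} (h : H.Reachable v w) (hv : v ∈ X) :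
    w ∈ X := by
  obtain ⟨q⟩ := h
  induction q with
  | nil => exact hv
  | cons hadj _ ih => exact ih (hX _ hv _ hadj)

/-- After deleting an edge from a connected graph, every vertex is still joined to one of the
endpoints of the deleted edge. -/
theorem reachable_or_reachable_of_deleted_edge {V : Type*} {S : Set (Sym2 V)}
    (hS : (fromEdgeSet S).Connected) (x y v : V) :
    (fromEdgeSet (S \ {s(x, y)})).Reachable x v ∨ (fromEdgeSet (S \ {s(x, y)})).Reachable y v := by
  refine (hS.preconnected x v).mem_of_closed
    (X := {v | (fromEdgeSet (S \ {s(x, y)})).Reachable x v ∨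
      (fromEdgeSet (S \ {s(x, y)})).Reachable y v}) ?_ (Or.inl (Reachable.refl x))
  intro v hv w hvw
  rw [fromEdgeSet_adj] at hvw
  by_cases h : s(v, w) = s(x, y)
  · rcases Sym2.eq_iff.mp h with ⟨-, rfl⟩ | ⟨-, rfl⟩
    · exact Or.inr (Reachable.refl _)
    · exact Or.inl (Reachable.refl _)
  · have hadj : (fromEdgeSet (S \ {s(x, y)})).Adj v w :=
      (fromEdgeSet_adj _).mpr ⟨⟨hvw.1, h⟩, hvw.2⟩
    exact hv.imp (fun h => h.trans hadj.reachable) (fun h => h.trans hadj.reachable)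

/-- Exchanging an edge of a spanning tree for another edge gives a spanning tree as soon as the
result is connected. -/
theorem IsSpanningTree.exchange {V : Type*} [Finite V] {G : SimpleGraph V} {S : Set (Sym2 V)}
    (hS : IsSpanningTree G S) {e f : Sym2 V} (he : e ∈ S) (hf : f ∈ G.edgeSet) (hfS : f ∉ S)
    (hconn : (fromEdgeSet (insert f (S \ {e}))).Connected) :
    IsSpanningTree G (insert f (S \ {e})) := by
  have hsub : insert f (S \ {e}) ⊆ G.edgeSet :=
    Set.insert_subset hf (Set.sdiff_subset.trans hS.1)
  have hedge : ∀ T ⊆ G.edgeSet, (fromEdgeSet T).edgeSet = T := fun T hT => by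
    rw [edgeSet_fromEdgeSet, sdiff_eq_left, ← Set.subset_compl_iff_disjoint_right]
    exact hT.trans G.edgeSet_subset_compl_diagSet
  refine ⟨hsub, isTree_iff_connected_and_card.mpr ⟨hconn, ?_⟩⟩
  have hcard := (isTree_iff_connected_and_card.mp hS.2).2
  rw [hedge _ hS.1, Nat.card_coe_set_eq] at hcard
  rw [hedge _ hsub, Nat.card_coe_set_eq, Set.ncard_exchange hfS he, hcard]

/-- An interior vertex of degree two on a path has only its two path neighbours. -/
theorem SimpleGraph.Walk.IsPath.eq_getVert_of_adj {V : Type*} [Fintype V] {G : SimpleGraph V}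
    [DecidableRel G.Adj] {a b : V} {p : G.Walk a b} (hp : p.IsPath) {i : ℕ}
    (hi : i + 1 < p.length) (hdeg : G.degree (p.getVert (i + 1)) = 2) {w : V}
    (hw : G.Adj (p.getVert (i + 1)) w) :
    w = p.getVert i ∨ w = p.getVert (i + 2) := by
  classical
  have hne : p.getVert i ≠ p.getVert (i + 2) := fun h => by
    have := hp.getVert_injOn (show i ≤ p.length by lia) (show i + 2 ≤ p.length by lia) h
    lia
  have hsub : {p.getVert i, p.getVert (i + 2)} ⊆ G.neighborFinset (p.getVert (i + 1)) := by
    intro v hv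
    rw [mem_neighborFinset]
    rcases Finset.mem_insert.mp hv with rfl | hv
    · exact (p.adj_getVert_succ (by lia)).symm
    · rw [Finset.mem_singleton.mp hv]
      exact p.adj_getVert_succ hi
  have heq := Finset.eq_of_subset_of_card_le hsub
    (by rw [card_neighborFinset_eq_degree, hdeg, Finset.card_pair hne])
  have hmem := (G.mem_neighborFinset _ _).mpr hw
  rw [← heq] at hmem
  simpa using hmem

/-- If the spanning tree `S` contains the edges `e 1, …, e k` of an
ordered-consecutive 2-path but not the first edge `e 0`, then every edge `e m` with
`1 ≤ m ≤ k` is internally inactive with respect to `S`. -/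
theorem two_path_omitting_first_edge_rest_internally_inactive
    {V : Type*} [Fintype V] [DecidableEq V] [LinearOrder (Sym2 V)]
    (G : SimpleGraph V) [DecidableRel G.Adj] (hG : G.Connected)
    (S : Set (Sym2 V)) (hS : IsSpanningTree G S)
    (k : ℕ) (hk : 1 ≤ k) {a b : V} (p : G.Walk a b) (hp : p.IsPath)
    (e : Fin (k + 1) → Sym2 V) (he : p.edges = List.ofFn e)
    (hdeg : ∀ v ∈ p.support, v ≠ a → v ≠ b → G.degree v = 2)
    (hmono : ∀ m : Fin k, e m.castSucc < e m.succ)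
    (hconsec : ∀ m : Fin k, ∀ f ∈ G.edgeSet, ¬ (e m.castSucc < f ∧ f < e m.succ))
    (hout : e 0 ∉ S) (hin : ∀ m : Fin (k + 1), m ≠ 0 → e m ∈ S) :
    ∀ m : Fin (k + 1), m ≠ 0 → InternallyInactive G S (e m) := by
  have hlen : p.length = k + 1 := by
    rw [← p.length_edges, he, List.length_ofFn]
  have hedge : ∀ (i : ℕ) (hi : i < k + 1), e ⟨i, hi⟩ = s(p.getVert i, p.getVert (i + 1)) := by
    intro i hi
    rw [← p.getElem_edges (by rw [p.length_edges, hlen]; exact hi)]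
    simp only [he, List.getElem_ofFn]
  have hinj : ∀ {i j : ℕ}, i ≤ k + 1 → j ≤ k + 1 → p.getVert i = p.getVert j → i = j :=
    fun hi hj h => hp.getVert_injOn (hi.trans_eq hlen.symm) (hj.trans_eq hlen.symm) h
  have hlt : StrictMono e := Fin.strictMono_iff_lt_succ.mpr hmono
  intro m hm
  refine ⟨hin m hm, fun hact => ?_⟩
  obtain ⟨m, hmk⟩ := m
  have hm0 : 1 ≤ m := Nat.one_le_iff_ne_zero.mpr fun h => hm (Fin.ext h)
  have he0 : e 0 = s(p.getVert 0, p.getVert 1) := hedge 0 (by lia)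
  have hem := hedge m hmk
  have he0G : e 0 ∈ G.edgeSet := by
    rw [he0]
    exact p.adj_getVert_succ (by lia)
  have hmemS : ∀ i, 1 ≤ i → i < k + 1 → s(p.getVert i, p.getVert (i + 1)) ∈ S := by
    intro i hi hik
    rw [← hedge i hik]
    exact hin _ fun h => by simp [Fin.ext_iff] at h; lia
  refine (hact.2 (e 0) he0G ?_).not_gt (hlt (Fin.pos_of_ne_zero hm))
  refine hS.exchange (hin _ hm) he0G hout ?_
  set H := fromEdgeSet (insert (e 0) (S \ {e ⟨m, hmk⟩})) with hH
  have hle : fromEdgeSet (S \ {e ⟨m, hmk⟩}) ≤ H := fromEdgeSet_mono (Set.subset_insert _ _)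
  -- The segment of the path from its second vertex to the deleted edge is a union of components.
  have hclosed : ∀ v ∈ {v | ∃ i, 1 ≤ i ∧ i ≤ m ∧ v = p.getVert i}, ∀ w,
      (fromEdgeSet (S \ {e ⟨m, hmk⟩})).Adj v w →
        w ∈ {v | ∃ i, 1 ≤ i ∧ i ≤ m ∧ v = p.getVert i} := by
    rintro _ ⟨i, hi1, him, rfl⟩ w hw
    obtain ⟨⟨hwS, hwe⟩, -⟩ := (fromEdgeSet_adj _).mp hw
    obtain ⟨i, rfl⟩ := Nat.exists_eq_add_of_le' hi1
    have hd : G.degree (p.getVert (i + 1)) = 2 := by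
      refine hdeg _ (p.getVert_mem_support _) (fun h => ?_) (fun h => ?_)
      · have := (hp.getVert_eq_start_iff (by lia)).mp h
        lia
      · have := (hp.getVert_eq_end_iff (by lia)).mp h
        lia
    rcases hp.eq_getVert_of_adj (by lia) hd (hS.1 hwS) with rfl | rfl
    · rcases Nat.eq_zero_or_pos i with rfl | hi
      · refine (hout ?_).elim
        rw [he0, Sym2.eq_swap]
        exact hwS
      · exact ⟨i, hi, by lia, rfl⟩
    · rcases him.eq_or_lt with rfl | him
      · exact (hwe hem.symm).elim
      · exact ⟨i + 2, by lia, by lia, rfl⟩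
  have hdel := fun v => reachable_or_reachable_of_deleted_edge hS.2.connected
    (p.getVert m) (p.getVert (m + 1)) v
  rw [← hem] at hdel
  have hstart : H.Reachable (p.getVert (m + 1)) (p.getVert 0) := by
    refine ((hdel (p.getVert 0)).resolve_left fun h => ?_).mono hle
    obtain ⟨i, hi1, him, hi⟩ := h.mem_of_closed hclosed ⟨m, hm0, le_rfl, rfl⟩
    have := hinj (by lia) (by lia) hi
    lia
  have hfirst : H.Adj (p.getVert 0) (p.getVert 1) :=
    (fromEdgeSet_adj _).mpr ⟨Or.inl he0.symm, (p.adj_getVert_succ (by lia)).ne⟩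
  have hseg : ∀ i, 1 ≤ i → i ≤ m → H.Reachable (p.getVert 1) (p.getVert i) := by
    intro i hi
    induction i, hi using Nat.le_induction with
    | base => exact fun _ => Reachable.refl _
    | succ i hi ih =>
      intro him
      refine (ih (by lia)).trans (Adj.reachable ((fromEdgeSet_adj _).mpr
        ⟨Or.inr ⟨hmemS i hi (by lia), fun h => ?_⟩, (p.adj_getVert_succ (by lia)).ne⟩))
      rw [Set.mem_singleton_iff, ← hedge i (by lia)] at h
      have := congrArg Fin.val (hlt.injective h)
      simp only at this
      lia
  have hends : H.Reachable (p.getVert (m + 1)) (p.getVert m) :=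
    (hstart.trans hfirst.reachable).trans (hseg m hm0 le_rfl)
  refine (connected_iff_exists_forall_reachable H).mpr ⟨p.getVert (m + 1), fun v => ?_⟩
  exact (hdel v).elim (fun h => hends.trans (h.mono hle)) (fun h => h.mono hle)
end

section
/- Let G be a generalized theta graph with paths P_1, …, P_k (k ≥ 2) between u and v, where P_j has n_j ≥ 1 edges, and linearly order the edges of G so that within each P_j the edges are indexed consecutively along the path (call these positions 1, …, n_j) and every edge of P_j precedes every edge of P_{j'} whenever j < j'. Let S be the spanning tree of G determined as follows: S contains all edges of P_i for some fixed i, and for each j ≠ i it omits exactly the edge of P_j at position m_j (1 ≤ m_j ≤ n_j). Then the activity letters with respect to S are: (a) if i = 1, every edge of P_1 is internally active, while if i ≥ 2, every edge of P_i is internally inactive; (b) for each j ≠ i, the edges of P_j at positions strictly less than m_j are internally active, the edges at positions strictly greater than m_j are internally inactive, and the omitted edge at position m_j is externally active if j < i and m_j = 1, and externally inactive otherwise. -/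
namespace IsSpanningTree

variable {V : Type*} {G : SimpleGraph V} {S : Set (Sym2 V)}

theorem edgeSet_fromEdgeSet_of_subset (h : S ⊆ G.edgeSet) :
    (SimpleGraph.fromEdgeSet S).edgeSet = S := by
  rw [SimpleGraph.edgeSet_fromEdgeSet, sdiff_eq_left, Set.disjoint_left]
  exact fun e he hd => G.not_isDiag_of_mem_edgeSet (h he) hd

theorem ncard_add_one [Finite V] (h : IsSpanningTree G S) : S.ncard + 1 = Nat.card V := by
  have := (SimpleGraph.isTree_iff_connected_and_card.mp h.2).2
  rwa [edgeSet_fromEdgeSet_of_subset h.1, Nat.card_coe_set_eq] at this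

/-- In an exchange of edges of a spanning tree, the new edge is the removed edge or lies
outside the tree. -/
theorem eq_or_notMem_of_exchange [Finite V] (h : IsSpanningTree G S) {e f : Sym2 V} (he : e ∈ S)
    (hf : IsSpanningTree G (insert f (S \ {e}))) : f = e ∨ f ∉ S := by
  by_contra! hc
  have h1 := hf.ncard_add_one
  rw [Set.insert_eq_of_mem (show f ∈ S \ {e} from ⟨hc.2, hc.1⟩)] at h1
  have h2 := h.ncard_add_one
  have := Set.ncard_sdiff_singleton_add_one he (Set.toFinite S)
  omega

/-- An edge of a spanning tree lying on a cycle of the tree plus one new edge can be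
exchanged for the new edge. -/
theorem exchange_s7 [Finite V] (h : IsSpanningTree G S) {e f : Sym2 V} (he : e ∈ S)
    (hf : f ∈ G.edgeSet) (hfS : f ∉ S) {w : V}
    {c : (SimpleGraph.fromEdgeSet (insert f S)).Walk w w} (hc : c.IsCycle) (hec : e ∈ c.edges) :
    IsSpanningTree G (insert f (S \ {e})) := by
  have hfe : f ≠ e := fun h => hfS (h ▸ he)
  have hsub : insert f (S \ {e}) ⊆ G.edgeSet :=
    Set.insert_subset hf (Set.sdiff_subset.trans h.1)
  refine ⟨hsub, SimpleGraph.isTree_iff_connected_and_card.mpr ⟨?_, ?_⟩⟩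
  · have hconn : (SimpleGraph.fromEdgeSet (insert f S)).Connected :=
      h.2.connected.mono (SimpleGraph.fromEdgeSet_mono (Set.subset_insert _ _))
    rw [Set.insert_sdiff_singleton_comm hfe, ← SimpleGraph.deleteEdges_fromEdgeSet]
    induction e with | _ x y =>
    exact hconn.connected_delete_edge_of_not_isBridge
      fun hb => hb.notMem_edges_of_isCycle hc hec
  · rw [edgeSet_fromEdgeSet_of_subset hsub, Nat.card_coe_set_eq,
      Set.ncard_insert_of_notMem (fun h => hfS h.1),
      Set.ncard_sdiff_singleton_add_one he (Set.toFinite S)]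
    exact h.ncard_add_one

end IsSpanningTree

namespace SimpleGraph.Walk

variable {V : Type*} {G H : SimpleGraph V} {u v : V}

/-- If the vertices of a path `p` strictly after position `a` and up to position `b` meet
no edge of `G` outside `p`, then a connected subgraph of `G` on the same vertices contains
the edge of `p` at position `a` or the one at position `b`. -/
theorem IsPath.mem_edgeSet_or_of_connected {p : G.Walk u v} (hp : p.IsPath) {a b : ℕ}
    (hab : a < b) (hb : b < p.length)
    (hA : ∀ t, a < t → t ≤ b → ∀ w, G.Adj (p.getVert t) w → s(p.getVert t, w) ∈ p.edges)
    (hHG : H ≤ G) (hH : H.Connected) :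
    s(p.getVert a, p.getVert (a + 1)) ∈ H.edgeSet ∨
      s(p.getVert b, p.getVert (b + 1)) ∈ H.edgeSet := by
  have hinj : ∀ {x y}, x ≤ p.length → y ≤ p.length → p.getVert x = p.getVert y → x = y :=
    fun hx hy h => hp.getVert_injOn hx hy h
  obtain ⟨q⟩ := hH.preconnected (p.getVert b) (p.getVert 0)
  obtain ⟨d, -, ⟨t, hat, htb, ht⟩, hd⟩ := q.exists_boundary_dart
    {w | ∃ t, a < t ∧ t ≤ b ∧ p.getVert t = w} ⟨b, hab, le_rfl, rfl⟩ (by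
      rintro ⟨t, hat, htb, ht⟩
      have := hinj (by omega) (by omega) ht
      omega)
  have hadj := d.adj
  rw [← ht] at hadj
  obtain ⟨r, hr, hrt⟩ := (mk_mem_edges_iff_exists p).mp (hA t hat htb _ (hHG hadj))
  rcases Sym2.eq_iff.mp hrt with ⟨h1, h2⟩ | ⟨h1, h2⟩
  · have hrt' := hinj (by omega) (by omega) h1
    subst hrt'
    have : ¬ r + 1 ≤ b := fun h => hd ⟨r + 1, by omega, h, h2⟩
    obtain rfl : r = b := by omega
    right
    rw [h2]
    exact hadj
  · have hrt' := hinj (by omega) (by omega) h2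
    subst hrt'
    have : ¬ a < r := fun h => hd ⟨r, h, by omega, h1⟩
    obtain rfl : r = a := by omega
    left
    rw [h1]
    exact hadj.symm

/-- Two internally disjoint paths with the same distinct endpoints, not both of length one,
form a cycle. -/
theorem IsPath.isCycle_append_reverse {p q : G.Walk u v} (hp : p.IsPath) (hq : q.IsPath)
    (hd : ∀ w, w ∈ p.support → w ∈ q.support → w = u ∨ w = v)
    (hl : 1 < p.length ∨ 1 < q.length) : (p.append q.reverse).IsCycle := by
  refine hp.isCycle_append hq.reverse ?_ (by simpa using hl)
  intro w hw hw'
  have h1 := hp.support_nodup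
  have h2 := hq.reverse.support_nodup
  rw [← cons_tail_support] at h1 h2
  rcases hd w (List.mem_of_mem_tail hw) (by simpa using List.mem_of_mem_tail hw') with rfl | rfl
  · exact (List.nodup_cons.mp h1).1 hw
  · exact (List.nodup_cons.mp h2).1 hw'

end SimpleGraph.Walk

/-- In a generalized theta graph whose edges are linearly ordered
increasingly along each path `P j` (via the indexing `ε j`) and with every edge of
`P j` preceding every edge of `P j'` for `j < j'`, consider the spanning tree `S`
containing all edges of `P i` and omitting exactly the edge at position `m j` of each
`P j` with `j ≠ i`.  Then: (a) if `i` is the first path every edge of `P i` is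
internally active, and otherwise every edge of `P i` is internally inactive; and
(b) for `j ≠ i`, edges of `P j` before position `m j` are internally active, edges
after position `m j` are internally inactive, and the omitted edge is externally
active exactly when `j < i` and `m j` is the first position, and externally inactive
otherwise. -/
theorem theta_graph_activity_letters
    {V : Type*} [Fintype V] [DecidableEq V] [LinearOrder (Sym2 V)]
    (G : SimpleGraph V) {u v : V} (huv : u ≠ v)
    (k : ℕ) (hk : 2 ≤ k) (n : Fin k → ℕ) (hn : ∀ j, 1 ≤ n j)
    (hone : ∀ j j', n j = 1 → n j' = 1 → j = j')
    (P : Fin k → G.Walk u v)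
    (hpath : ∀ j, (P j).IsPath)
    (hdisj : ∀ j j', j ≠ j' → ∀ w, w ∈ (P j).support → w ∈ (P j').support →
      w = u ∨ w = v)
    (hvert : ∀ w : V, ∃ j, w ∈ (P j).support)
    (ε : (j : Fin k) → Fin (n j) → Sym2 V)
    (hε : ∀ j, (P j).edges = List.ofFn (ε j))
    (hedge : ∀ f, f ∈ G.edgeSet ↔ ∃ j, f ∈ (P j).edges)
    (hordwithin : ∀ j, ∀ s t : Fin (n j), s < t → ε j s < ε j t)
    (hordacross : ∀ j j' : Fin k, j < j' → ∀ (s : Fin (n j)) (t : Fin (n j')),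
      ε j s < ε j' t)
    (i : Fin k) (m : (j : Fin k) → Fin (n j))
    (S : Set (Sym2 V))
    (hSdef : S = {f | f ∈ G.edgeSet ∧ ∀ j, j ≠ i → f ≠ ε j (m j)})
    (hS : IsSpanningTree G S) :
    -- (a)
    (((i : ℕ) = 0 → ∀ s : Fin (n i), InternallyActive G S (ε i s)) ∧
      ((i : ℕ) ≠ 0 → ∀ s : Fin (n i), InternallyInactive G S (ε i s))) ∧
    -- (b)
    (∀ j, j ≠ i →
      (∀ s : Fin (n j), s < m j → InternallyActive G S (ε j s)) ∧
      (∀ s : Fin (n j), m j < s → InternallyInactive G S (ε j s)) ∧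
      ((j < i ∧ (m j : ℕ) = 0) → ExternallyActive G S (ε j (m j))) ∧
      (¬ (j < i ∧ (m j : ℕ) = 0) → ExternallyInactive G S (ε j (m j)))) := by
  have hlen : ∀ j, (P j).length = n j := fun j => by
    rw [← SimpleGraph.Walk.length_edges, hε, List.length_ofFn]
  have hmem : ∀ j s, ε j s ∈ (P j).edges := fun j s => by
    rw [hε, List.mem_ofFn]; exact ⟨s, rfl⟩
  have hG : ∀ j s, ε j s ∈ G.edgeSet := fun j s => (hedge _).mpr ⟨j, hmem j s⟩
  have hval : ∀ j (s : Fin (n j)), ε j s = s((P j).getVert s, (P j).getVert (s + 1)) := by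
    intro j s
    rw [← SimpleGraph.Walk.getElem_edges (by simp [hlen])]
    simp [hε]
  have hexists : ∀ f ∈ G.edgeSet, ∃ j s, f = ε j s := by
    intro f hf
    obtain ⟨j, hj⟩ := (hedge f).mp hf
    rw [hε, List.mem_ofFn] at hj
    obtain ⟨s, rfl⟩ := hj
    exact ⟨j, s, rfl⟩
  have hne : ∀ {j j'}, j ≠ j' → ∀ s t, ε j s ≠ ε j' t := by
    intro j j' h s t
    rcases lt_or_gt_of_ne h with h | h
    · exact (hordacross _ _ h s t).ne
    · exact (hordacross _ _ h t s).ne'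
  have hmono : ∀ j, StrictMono (ε j) := fun j s t => hordwithin j s t
  have hSi : ∀ s, ε i s ∈ S := fun s => hSdef ▸ ⟨hG i s, fun j hj => hne hj.symm _ _⟩
  have hSj : ∀ j (s : Fin (n j)), s ≠ m j → ε j s ∈ S := by
    intro j s hs
    refine hSdef ▸ ⟨hG j s, fun j' _ => ?_⟩
    by_cases h : j = j'
    · subst h
      exact (hmono j).injective.ne hs
    · exact hne h _ _
  have hSm : ∀ j, j ≠ i → ε j (m j) ∉ S := fun j hj h => by
    rw [hSdef] at h
    exact h.2 j hj rfl
  have hnotS : ∀ f ∈ G.edgeSet, f ∉ S → ∃ j, j ≠ i ∧ f = ε j (m j) := by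
    intro f hf hfS
    by_contra! hc
    exact hfS (hSdef ▸ ⟨hf, hc⟩)
  have hinterior : ∀ j (t : ℕ), 0 < t → t < n j → ∀ w, G.Adj ((P j).getVert t) w →
      s((P j).getVert t, w) ∈ (P j).edges := by
    intro j t ht0 htn w hw
    obtain ⟨j', hj'⟩ := (hedge s((P j).getVert t, w)).mp hw
    by_cases h : j = j'
    · exact h ▸ hj'
    rcases hdisj j j' h _ ((P j).getVert_mem_support t)
      ((P j').fst_mem_support_of_mem_edges hj') with hu | hv
    · have := ((hpath j).getVert_eq_start_iff (by rw [hlen]; omega)).mp hu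
      omega
    · have := ((hpath j).getVert_eq_end_iff (by rw [hlen]; omega)).mp hv
      rw [hlen] at this
      omega
  have hcut : ∀ j, j ≠ i → ∀ s, s ≠ m j → ∀ f, IsSpanningTree G (insert f (S \ {ε j s})) →
      f = ε j s ∨ f = ε j (m j) := by
    intro j hj s hs f hf
    have hcross : ∀ a b : Fin (n j), a < b →
        ε j a ∈ insert f (S \ {ε j s}) ∨ ε j b ∈ insert f (S \ {ε j s}) := by
      intro a b hab
      have := (hpath j).mem_edgeSet_or_of_connected (a := a) (b := b) hab (by rw [hlen]; exact b.2)
        (fun t hat htb => hinterior j t (by omega) (by omega))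
        (H := SimpleGraph.fromEdgeSet (insert f (S \ {ε j s})))
        (by rw [← SimpleGraph.fromEdgeSet_edgeSet (G := G)]
            exact SimpleGraph.fromEdgeSet_mono hf.1) hf.2.connected
      rwa [IsSpanningTree.edgeSet_fromEdgeSet_of_subset hf.1, ← hval, ← hval] at this
    have hms := hSm j hj
    rcases lt_or_gt_of_ne hs with h | h
    · have := hcross _ _ h
      simp only [Set.mem_insert_iff, Set.mem_sdiff, Set.mem_singleton_iff] at this
      tauto
    · have := hcross _ _ h
      simp only [Set.mem_insert_iff, Set.mem_sdiff, Set.mem_singleton_iff] at this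
      tauto
  have hcycle : ∀ j, j ≠ i →
      ∃ c : (SimpleGraph.fromEdgeSet (insert (ε j (m j)) S)).Walk u u, c.IsCycle ∧
        (∀ s, ε i s ∈ c.edges) ∧ ∀ s, ε j s ∈ c.edges := by
    intro j hj
    have hc := (hpath i).isCycle_append_reverse (hpath j) (hdisj i j hj.symm) (by
      rw [hlen, hlen]
      by_contra! h
      exact hj (hone j i (le_antisymm h.2 (hn j)) (le_antisymm h.1 (hn i))))
    have hsub : insert (ε j (m j)) S ⊆ G.edgeSet := Set.insert_subset (hG _ _) hS.1
    have hc' : ∀ f ∈ ((P i).append (P j).reverse).edges,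
        f ∈ (SimpleGraph.fromEdgeSet (insert (ε j (m j)) S)).edgeSet := by
      intro f hf
      rw [IsSpanningTree.edgeSet_fromEdgeSet_of_subset hsub]
      simp only [SimpleGraph.Walk.edges_append, SimpleGraph.Walk.edges_reverse, List.mem_append,
        List.mem_reverse, hε, List.mem_ofFn] at hf
      rcases hf with ⟨s, rfl⟩ | ⟨s, rfl⟩
      · exact Or.inr (hSi s)
      · by_cases h : s = m j
        · exact Or.inl (h ▸ rfl)
        · exact Or.inr (hSj j s h)
    refine ⟨_, hc.transfer hc', fun s => ?_, fun s => ?_⟩ <;>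
      simp [SimpleGraph.Walk.edges_transfer, hmem]
  have hinactive : ∀ e ∈ S, ∀ j, j ≠ i → ε j (m j) < e → ((∃ s, e = ε i s) ∨ ∃ s, e = ε j s) →
      InternallyInactive G S e := by
    intro e he j hj hlt hec
    obtain ⟨c, hc, hci, hcj⟩ := hcycle j hj
    have hec' : e ∈ c.edges := by
      rcases hec with ⟨s, rfl⟩ | ⟨s, rfl⟩
      · exact hci s
      · exact hcj s
    exact ⟨he, fun h =>
      (h.2 _ (hG _ _) (hS.exchange_s7 he (hG _ _) (hSm j hj) hc hec')).not_gt hlt⟩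
  refine ⟨⟨fun hi s => ⟨hSi s, fun f hf hT => ?_⟩, fun hi s => ?_⟩, fun j hj =>
    ⟨fun s hs => ⟨hSj j s hs.ne, fun f hf hT => ?_⟩, fun s hs => ?_, fun h => ?_, fun h => ?_⟩⟩
  · rcases hS.eq_or_notMem_of_exchange (hSi s) hT with rfl | hfS
    · exact le_rfl
    · obtain ⟨j, hj, rfl⟩ := hnotS f hf hfS
      exact (hordacross i j (by omega) _ _).le
  · have h0 : (⟨0, by omega⟩ : Fin k) < i := Fin.lt_def.mpr (Nat.pos_of_ne_zero hi)
    exact hinactive _ (hSi s) _ h0.ne (hordacross _ _ h0 _ _) (Or.inl ⟨s, rfl⟩)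
  · rcases hcut j hj s hs.ne f hT with rfl | rfl
    · exact le_rfl
    · exact (hmono j hs).le
  · exact hinactive _ (hSj j s hs.ne') j hj (hmono j hs) (Or.inr ⟨s, rfl⟩)
  · refine ⟨hG _ _, hSm j hj, fun w c hc f hf => ?_⟩
    have hfm := c.edges_subset_edgeSet hf
    rw [IsSpanningTree.edgeSet_fromEdgeSet_of_subset
      (Set.insert_subset (hG _ _) hS.1)] at hfm
    rcases hfm with rfl | hfS
    · exact le_rfl
    have hT := hS.exchange_s7 hfS (hG _ _) (hSm j hj) hc hf
    obtain ⟨j', s, rfl⟩ := hexists f (hS.1 hfS)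
    rcases lt_trichotomy j j' with hjj | rfl | hjj
    · exact (hordacross _ _ hjj _ _).le
    · exact (hmono j).monotone (Fin.le_def.mpr (by omega))
    · have hj' : j' ≠ i := (hjj.trans h.1).ne
      have hs : s ≠ m j' := by
        rintro rfl
        exact hSm j' hj' hfS
      rcases hcut j' hj' s hs _ hT with h' | h' <;> exact absurd h' (hne hjj.ne' _ _)
  · refine ⟨hG _ _, hSm j hj, fun hact => ?_⟩
    obtain ⟨c, hc, hci, hcj⟩ := hcycle j hj
    rcases lt_or_gt_of_ne hj with hji | hij
    · have h0 : (⟨0, hn j⟩ : Fin (n j)) < m j :=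
        Fin.lt_def.mpr (Nat.pos_of_ne_zero fun h0 => h ⟨hji, h0⟩)
      exact (hact.2.2 u c hc _ (hcj _)).not_gt (hmono j h0)
    · exact (hact.2.2 u c hc _ (hci (m i))).not_gt (hordacross _ _ hij _ _)
end

section
/- Let k ≥ 2 and n_1, …, n_k ≥ 1 be integers, n = n_1 + ⋯ + n_k, and set N_0 = 0, N_j = n_1 + ⋯ + n_j. In the polynomial ring ℤ[L, D, ℓ, d], define the n × n matrix A (the unenhanced activity matrix of the all-positive pretzel link P(n_1, …, n_k)) with rows indexed 1, …, n and columns consisting of: a column (j, s) for each 1 ≤ j ≤ k and 1 ≤ s ≤ n_j − 1; a column c_0; and columns c_1, …, c_{k−1}. The nonzero entries of A are exactly: A[N_{j−1}+s, (j,s)] = L and A[N_{j−1}+s+1, (j,s)] = D for 1 ≤ j ≤ k, 1 ≤ s ≤ n_j − 1; A[N_1, c_0] = L and A[N_{j−1}+1, c_0] = D for 2 ≤ j ≤ k; and, for 1 ≤ i ≤ k−1, A[N_{i−1}+1, c_i] = ℓ and A[r, c_i] = d for every row r with N_{i−1}+1 < r ≤ N_{i+1}. Then the permanent of A equals L^{n_1}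 · Π_{j=2}^{k} E_j + Σ_{i=2}^{k} D^{n_i} · Π_{j=1}^{i−1} (ℓ·D^{n_j−1} + F_j) · Π_{j=i+1}^{k} E_j, where E_j = Σ_{m=1}^{n_j} L^{m−1} d D^{n_j−m} and F_j = Σ_{m=2}^{n_j} L^{m−1} d D^{n_j−m}. -/
open MvPolynomial

/-- Partial sums `N j = n 1 + ⋯ + n j` of the numbers of crossings in the columns. -/
def crossingSum (n : ℕ → ℕ) (j : ℕ) : ℕ := ∑ t ∈ Finset.range j, n t

open scoped Classical in
/-- The unenhanced activity matrix of the all-positive pretzel link `P(n 1, …, n k)`,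
an `n × n` matrix over `ℤ[L, D, ℓ, d]` (with `L = X 0`, `D = X 1`, `ℓ = X 2`,
`d = X 3`), written with `0`-based rows and columns.  The columns are laid out as:
first the block columns `(j, s)` (`0 ≤ j < k`, `0 ≤ s < n j - 1`, the column `(j, s)`
sitting at position `(N j - j) + s`), then the column `c 0` at position `N k - k`,
then the columns `c i` (`1 ≤ i ≤ k - 1`) at positions `N k - k + i`.  Its nonzero
entries are exactly: `L` at row `N j + s` and `D` at row `N j + s + 1` of block
column `(j, s)`; `L` at row `N 1 - 1` and `D` at the rows `N j` (`1 ≤ j ≤ k - 1`) of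
column `c 0`; and `ℓ` at row `N (i-1)` and `d` at the rows `r` with
`N (i-1) < r < N (i+1)` of column `c i`. -/
noncomputable def pretzelActivityMatrix (k : ℕ) (n : ℕ → ℕ) :
    Matrix (Fin (crossingSum n k)) (Fin (crossingSum n k)) (MvPolynomial (Fin 4) ℤ) :=
  fun r c =>
    (if ∃ j < k, crossingSum n j ≤ (c : ℕ) + j ∧ (c : ℕ) + j + 1 < crossingSum n (j + 1) ∧
        (r : ℕ) = (c : ℕ) + j then X 0 else 0) +
    (if ∃ j < k, crossingSum n j ≤ (c : ℕ) + j ∧ (c : ℕ) + j + 1 < crossingSum n (j + 1) ∧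
        (r : ℕ) = (c : ℕ) + j + 1 then X 1 else 0) +
    (if (c : ℕ) = crossingSum n k - k ∧ (r : ℕ) + 1 = crossingSum n 1 then X 0 else 0) +
    (if (c : ℕ) = crossingSum n k - k ∧ ∃ j, 1 ≤ j ∧ j < k ∧ (r : ℕ) = crossingSum n j
        then X 1 else 0) +
    (if ∃ i, 1 ≤ i ∧ i < k ∧ (c : ℕ) = crossingSum n k - k + i ∧
        (r : ℕ) = crossingSum n (i - 1) then X 2 else 0) +
    (if ∃ i, 1 ≤ i ∧ i < k ∧ (c : ℕ) = crossingSum n k - k + i ∧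
        crossingSum n (i - 1) < (r : ℕ) ∧ (r : ℕ) < crossingSum n (i + 1) then X 3 else 0)

/-- `E j = Σ_{m=1}^{n j} L^{m-1} d D^{n j - m}` (here written with `m` running over
`0, …, n j - 1`). -/
noncomputable def pretzelE (n : ℕ → ℕ) (j : ℕ) : MvPolynomial (Fin 4) ℤ :=
  ∑ m ∈ Finset.range (n j), X 0 ^ m * X 3 * X 1 ^ (n j - 1 - m)

/-- `F j = Σ_{m=2}^{n j} L^{m-1} d D^{n j - m}` (here written with `m` running over
`1, …, n j - 1`). -/
noncomputable def pretzelF (n : ℕ → ℕ) (j : ℕ) : MvPolynomial (Fin 4) ℤ :=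
  ∑ m ∈ Finset.Ico 1 (n j), X 0 ^ m * X 3 * X 1 ^ (n j - 1 - m)

section ListPermanent

variable {R : Type*} [CommRing R]

/-- The permanent of the matrix with rows indexed by `S` and the listed columns,
defined by expansion along the first column; it is `0` unless there are as many columns as rows. -/
def listPermanent : Finset ℕ → List (ℕ → R) → R
  | S, [] => if S = ∅ then 1 else 0
  | S, v :: l => ∑ r ∈ S, v r * listPermanent (S.erase r) l

theorem listPermanent_cons (S : Finset ℕ) (v : ℕ → R) (l : List (ℕ → R)) :
    listPermanent S (v :: l) = ∑ r ∈ S, v r * listPermanent (S.erase r) l := by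
  rw [listPermanent]

theorem listPermanent_swap (S : Finset ℕ) (u v : ℕ → R) (l : List (ℕ → R)) :
    listPermanent S (u :: v :: l) = listPermanent S (v :: u :: l) := by
  simp only [listPermanent_cons, Finset.mul_sum]
  rw [Finset.sum_comm' (t' := S) (s' := fun r => S.erase r)]
  · refine Finset.sum_congr rfl fun r _ => Finset.sum_congr rfl fun s _ => ?_
    rw [Finset.erase_right_comm]
    ring
  · intro x y
    simp only [Finset.mem_erase]
    tauto

theorem listPermanent_perm {l l' : List (ℕ → R)} (h : l.Perm l') (S : Finset ℕ) :
    listPermanent S l = listPermanent S l' := by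
  induction h generalizing S with
  | nil => rfl
  | cons v _ ih => simp only [listPermanent_cons, ih]
  | swap u v l => exact listPermanent_swap S v u l
  | trans _ _ ih₁ ih₂ => exact (ih₁ S).trans (ih₂ S)

theorem listPermanent_eq_zero_of_row {S : Finset ℕ} {r : ℕ} (hr : r ∈ S) {l : List (ℕ → R)}
    (hl : ∀ v ∈ l, v r = 0) : listPermanent S l = 0 := by
  induction l generalizing S with
  | nil => simp [listPermanent, Finset.ne_empty_of_mem hr]
  | cons v l ih =>
    rw [listPermanent_cons]
    refine Finset.sum_eq_zero fun s _ => ?_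
    by_cases hs : s = r
    · simp [hs, hl v (by simp)]
    · rw [ih (Finset.mem_erase.2 ⟨Ne.symm hs, hr⟩) fun w hw => hl w (by simp [hw]), mul_zero]

theorem listPermanent_cons_eq_zero {S : Finset ℕ} {v : ℕ → R} (hv : ∀ r ∈ S, v r = 0)
    (l : List (ℕ → R)) : listPermanent S (v :: l) = 0 := by
  rw [listPermanent_cons]
  exact Finset.sum_eq_zero fun r hr => by rw [hv r hr, zero_mul]

theorem listPermanent_cons_of_row {T : Finset ℕ} {r : ℕ} (hr : r ∉ T) (u : ℕ → R)
    {l : List (ℕ → R)} (hl : ∀ v ∈ l, v r = 0) :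
    listPermanent (insert r T) (u :: l) = u r * listPermanent T l := by
  rw [listPermanent_cons, Finset.sum_insert hr, Finset.erase_insert hr, add_eq_left]
  refine Finset.sum_eq_zero fun s hs => ?_
  rw [listPermanent_eq_zero_of_row (r := r) _ hl, mul_zero]
  exact Finset.mem_erase.2 ⟨by rintro rfl; exact hr hs, Finset.mem_insert_self _ _⟩

theorem listPermanent_cons_cons_of_row {T : Finset ℕ} {r : ℕ} (hr : r ∉ T) (u v : ℕ → R)
    {l : List (ℕ → R)} (hl : ∀ w ∈ l, w r = 0) :
    listPermanent (insert r T) (u :: v :: l) =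
      u r * listPermanent T (v :: l) + v r * listPermanent T (u :: l) := by
  rw [listPermanent_cons, Finset.sum_insert hr, Finset.erase_insert hr,
    listPermanent_cons T u, Finset.mul_sum]
  congr 1
  refine Finset.sum_congr rfl fun s hs => ?_
  have hrs : r ≠ s := by rintro rfl; exact hr hs
  rw [Finset.erase_insert_of_ne hrs, listPermanent_cons_of_row _ _ hl]
  · ring
  · exact fun h => hr (Finset.mem_of_mem_erase h)

theorem listPermanent_ofFn {m : ℕ} (c : Fin m → ℕ → R) (S : Finset ℕ) {B : ℕ}
    (hS : S ⊆ Finset.range B) :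
    listPermanent S (List.ofFn c) =
      ∑ f : Fin m → Fin B,
        if Function.Injective f ∧ Finset.univ.image (fun i => (f i : ℕ)) = S then
          ∏ i, c i (f i) else 0 := by
  induction m generalizing S with
  | zero =>
    simp [listPermanent, Function.injective_of_subsingleton, eq_comm]
  | succ m ih =>
    rw [List.ofFn_succ, listPermanent_cons, ← (Fin.consEquiv fun _ => Fin B).sum_comp,
      Fintype.sum_prod_type]
    have hsum : ∀ g : ℕ → R, ∑ r ∈ S, g r = ∑ r : Fin B, if (r : ℕ) ∈ S then g r else 0 := by
      intro g
      rw [Fin.sum_univ_eq_sum_range (fun r => if r ∈ S then g r else 0) B,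
        ← Finset.sum_filter, Finset.filter_mem_eq_inter, Finset.inter_eq_right.2 hS]
    rw [hsum]
    refine Finset.sum_congr rfl fun r _ => ?_
    by_cases hr : (r : ℕ) ∈ S
    · rw [if_pos hr, ih _ _ ((Finset.erase_subset _ _).trans hS), Finset.mul_sum]
      refine Finset.sum_congr rfl fun f _ => ?_
      rw [mul_ite, mul_zero]
      refine if_congr ?_ (by simp [Fin.prod_univ_succ]) rfl
      have hinj : Function.Injective (Fin.consEquiv (fun _ => Fin B) (r, f)) ↔
          r ∉ Set.range f ∧ Function.Injective f := Fin.cons_injective_iff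
      have himage : Finset.univ.image (fun i => (Fin.consEquiv (fun _ => Fin B) (r, f) i : ℕ)) =
          insert (r : ℕ) (Finset.univ.image fun i => (f i : ℕ)) := by
        ext x
        simp [Fin.exists_fin_succ, eq_comm]
      have hmem : (r : ℕ) ∈ Finset.univ.image (fun i => (f i : ℕ)) ↔ r ∈ Set.range f := by
        simp [Fin.ext_iff]
      rw [hinj, himage, ← hmem]
      constructor
      · rintro ⟨hf, h⟩
        refine ⟨⟨?_, hf⟩, ?_⟩
        · rw [h]; simp
        · rw [h, Finset.insert_erase hr]
      · rintro ⟨⟨h, hf⟩, h'⟩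
        exact ⟨hf, by rw [← h', Finset.erase_insert h]⟩
    · rw [if_neg hr]
      refine (Finset.sum_eq_zero fun f _ => if_neg ?_).symm
      rintro ⟨_, h⟩
      exact hr (h ▸ Finset.mem_image.2 ⟨0, Finset.mem_univ _, by simp⟩)

/-- The permanent of a matrix is the list permanent of its columns. -/
theorem permanent_eq_listPermanent (N : ℕ) (f : ℕ → ℕ → R) :
    Matrix.permanent (fun r c : Fin N => f c r) =
      listPermanent (Finset.range N) ((List.range N).map f) := by
  have hl : (List.range N).map f = List.ofFn fun c : Fin N => f c := by
    apply List.ext_getElem <;> simp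
  rw [hl, listPermanent_ofFn _ _ subset_rfl, ← Finset.sum_filter]
  unfold Matrix.permanent
  refine Finset.sum_bij (fun σ _ => ⇑σ) ?_ ?_ ?_ ?_
  · intro σ _
    simp only [Finset.mem_filter, Finset.mem_univ, true_and]
    refine ⟨σ.injective, ?_⟩
    ext x
    simp only [Finset.mem_image, Finset.mem_univ, true_and, Finset.mem_range]
    constructor
    · rintro ⟨i, rfl⟩
      exact (σ i).2
    · intro hx
      exact ⟨σ.symm ⟨x, hx⟩, by simp⟩
  · exact fun σ _ τ _ h => DFunLike.coe_injective h
  · intro g hg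
    have hg' := (Finset.mem_filter.1 hg).2.1
    exact ⟨Equiv.ofBijective g (Finite.injective_iff_bijective.1 hg'), Finset.mem_univ _, rfl⟩
  · exact fun σ _ => rfl

/-- The columns of a block: column `s` has `L` at row `a + s` and `D` at row `a + s + 1`. -/
def pathColumns (L D : R) (a m : ℕ) : List (ℕ → R) :=
  (List.range m).map fun s r => if r = a + s then L else if r = a + s + 1 then D else 0

theorem pathColumns_succ (L D : R) (a m : ℕ) :
    pathColumns L D a (m + 1) =
      (fun r => if r = a then L else if r = a + 1 then D else 0) :: pathColumns L D (a + 1) m := by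
  simp [pathColumns, List.range_succ_eq_map, Function.comp_def, add_assoc, add_comm 1]

theorem pathColumns_apply_eq_zero {L D : R} {a m r : ℕ} (hr : r < a ∨ a + m < r)
    {v : ℕ → R} (hv : v ∈ pathColumns L D a m) : v r = 0 := by
  simp only [pathColumns, List.mem_map, List.mem_range] at hv
  obtain ⟨s, hs, rfl⟩ := hv
  simp only [if_neg (show ¬ r = a + s by omega), if_neg (show ¬ r = a + s + 1 by omega)]

theorem listPermanent_pathColumns_of_notMem (L D : R) (a m : ℕ) {T : Finset ℕ}
    (hT : ∀ r ∈ T, r < a ∨ a + m < r) (l : List (ℕ → R)) :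
    listPermanent (Finset.Ioc a (a + m) ∪ T) (pathColumns L D a m ++ l) =
      D ^ m * listPermanent T l := by
  induction m generalizing a with
  | zero => simp [pathColumns]
  | succ m ih =>
    have ha : a ∉ T := fun h => by have := hT a h; omega
    have ha' : a + 1 ∉ T := fun h => by have := hT _ h; omega
    rw [pathColumns_succ, List.cons_append, listPermanent_cons,
      Finset.sum_eq_single (a + 1)]
    · have : (Finset.Ioc a (a + (m + 1)) ∪ T).erase (a + 1) =
          Finset.Ioc (a + 1) (a + 1 + m) ∪ T := by
        ext x
        simp only [Finset.mem_erase, Finset.mem_union, Finset.mem_Ioc]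
        by_cases hx : x = a + 1
        · subst hx; simp [ha']
        · simp only [ne_eq, hx, not_false_eq_true, true_and]
          apply or_congr_left; omega
      rw [this, ih (a + 1) fun r hr => by
        have := hT r hr
        have : r ≠ a := by rintro rfl; exact ha hr
        omega]
      simp [pow_succ']
      ring
    · intro r hr hne
      have : r ≠ a := by
        rintro rfl
        simp [ha] at hr
      simp [this, hne]
    · intro h
      simp at h

theorem listPermanent_pathColumns (L D : R) (a m : ℕ) {T : Finset ℕ}
    (hT : ∀ r ∈ T, r < a ∨ a + m < r) (l : List (ℕ → R)) :
    listPermanent (Finset.Icc a (a + m) ∪ T) (pathColumns L D a m ++ l) =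
      ∑ s ∈ Finset.range (m + 1), L ^ s * D ^ (m - s) * listPermanent (insert (a + s) T) l := by
  induction m generalizing a with
  | zero => simp [pathColumns]
  | succ m ih =>
    have hnot : ∀ x, a ≤ x → x ≤ a + (m + 1) → x ∉ T := fun x h₁ h₂ h => by
      have := hT x h
      omega
    have erase_first : (Finset.Icc a (a + (m + 1)) ∪ T).erase a =
        Finset.Icc (a + 1) (a + 1 + m) ∪ T := by
      ext x
      have := hnot x
      simp only [Finset.mem_erase, Finset.mem_union, Finset.mem_Icc]
      grind
    have erase_second : (Finset.Icc a (a + (m + 1)) ∪ T).erase (a + 1) =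
        Finset.Ioc (a + 1) (a + 1 + m) ∪ insert a T := by
      ext x
      have := hnot x
      simp only [Finset.mem_erase, Finset.mem_union, Finset.mem_Icc, Finset.mem_Ioc,
        Finset.mem_insert]
      grind
    rw [pathColumns_succ, List.cons_append, listPermanent_cons,
      Finset.sum_eq_add a (a + 1) (by omega), erase_first, erase_second,
      ih (a + 1) fun r hr => by have := hT r hr; omega,
      listPermanent_pathColumns_of_notMem, Finset.sum_range_succ' _ (m + 1), Finset.mul_sum]
    · congr 1
      · refine Finset.sum_congr rfl fun s _ => ?_
        rw [show a + 1 + s = a + (s + 1) by omega, Nat.add_sub_add_right, if_pos rfl, pow_succ]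
        ring
      · simp
        ring
    · intro r hr
      rcases Finset.mem_insert.1 hr with rfl | hr
      · omega
      · have := hT r hr
        omega
    · intro r _ hr
      simp [hr.1, hr.2]
    · intro h
      simp at h
    · intro h
      simp at h

/-- The contribution of a column `u` to the block with first row `a` and last row `a + m`. -/
def blockWeight (L D : R) (a m : ℕ) (u : ℕ → R) : R :=
  ∑ s ∈ Finset.range (m + 1), L ^ s * D ^ (m - s) * u (a + s)

theorem listPermanent_block_singleton (L D : R) (a m : ℕ) (u : ℕ → R) :
    listPermanent (Finset.Icc a (a + m)) (u :: pathColumns L D a m) = blockWeight L D a m u := by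
  have h := listPermanent_pathColumns L D a m (T := ∅) (by simp) [u]
  rw [Finset.union_empty] at h
  rw [listPermanent_perm (List.perm_append_singleton u _).symm, h, blockWeight]
  simp [listPermanent]

theorem listPermanent_block (L D : R) (a m : ℕ) {T : Finset ℕ} (hT : ∀ r ∈ T, r < a ∨ a + m < r)
    (u v : ℕ → R) {l : List (ℕ → R)} (hl : ∀ w ∈ l, ∀ r, a ≤ r → r ≤ a + m → w r = 0) :
    listPermanent (Finset.Icc a (a + m) ∪ T) (u :: (pathColumns L D a m ++ v :: l)) =
      blockWeight L D a m u * listPermanent T (v :: l) +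
        blockWeight L D a m v * listPermanent T (u :: l) := by
  rw [listPermanent_perm (List.perm_middle (a := u) (l₁ := pathColumns L D a m)).symm,
    listPermanent_pathColumns L D a m hT, blockWeight, blockWeight, Finset.sum_mul,
    Finset.sum_mul, ← Finset.sum_add_distrib]
  refine Finset.sum_congr rfl fun s hs => ?_
  have hs' := Finset.mem_range.1 hs
  rw [listPermanent_cons_cons_of_row]
  · ring
  · intro h
    have := hT _ h
    omega
  · exact fun w hw => hl w hw _ (by omega) (by omega)

/-- The columns of the blocks `j, …, j + t`, interleaved with the columns
`c (j + 1), …, c (j + t)` that join consecutive blocks. -/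
def chainColumns (L D : R) (n : ℕ → ℕ) (c : ℕ → ℕ → R) : ℕ → ℕ → List (ℕ → R)
  | j, 0 => pathColumns L D (crossingSum n j) (n j - 1)
  | j, t + 1 => pathColumns L D (crossingSum n j) (n j - 1) ++
      c (j + 1) :: chainColumns L D n c (j + 1) t

theorem crossingSum_succ (n : ℕ → ℕ) (j : ℕ) :
    crossingSum n (j + 1) = crossingSum n j + n j :=
  Finset.sum_range_succ _ _

theorem crossingSum_add_le {n : ℕ → ℕ} {k : ℕ} (hn : ∀ j < k, 1 ≤ n j) {i : ℕ} (t : ℕ)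
    (h : i + t ≤ k) : crossingSum n i + t ≤ crossingSum n (i + t) := by
  induction t with
  | zero => simp
  | succ t ih =>
    have := ih (by omega)
    have := hn (i + t) (by omega)
    rw [← add_assoc, ← add_assoc, crossingSum_succ]
    omega

theorem chainColumns_apply_eq_zero {L D : R} {n : ℕ → ℕ} {c : ℕ → ℕ → R} {k : ℕ}
    (hc : ∀ j, j + 1 < k → ∀ r < crossingSum n j, c (j + 1) r = 0)
    {j t r : ℕ} (hjt : j + t < k) (hr : r < crossingSum n j) {v : ℕ → R}
    (hv : v ∈ chainColumns L D n c j t) : v r = 0 := by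
  induction t generalizing j with
  | zero => exact pathColumns_apply_eq_zero (Or.inl hr) hv
  | succ t ih =>
    rw [chainColumns, List.mem_append, List.mem_cons] at hv
    rcases hv with hv | rfl | hv
    · exact pathColumns_apply_eq_zero (Or.inl hr) hv
    · exact hc j (by omega) r hr
    · refine ih (by omega) ?_ hv
      rw [crossingSum_succ]
      omega

theorem listPermanent_chainColumns_succ {L D : R} {n : ℕ → ℕ} {c : ℕ → ℕ → R} {k : ℕ}
    (hn : ∀ j < k, 1 ≤ n j) (hc : ∀ j, j + 1 < k → ∀ r < crossingSum n j, c (j + 1) r = 0)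
    {j t : ℕ} (hjt : j + (t + 1) < k) (u : ℕ → R) :
    listPermanent (Finset.Ico (crossingSum n j) (crossingSum n (j + (t + 1) + 1)))
        (u :: chainColumns L D n c j (t + 1)) =
      blockWeight L D (crossingSum n j) (n j - 1) u *
        listPermanent (Finset.Ico (crossingSum n (j + 1)) (crossingSum n (j + 1 + t + 1)))
          (c (j + 1) :: chainColumns L D n c (j + 1) t) +
      blockWeight L D (crossingSum n j) (n j - 1) (c (j + 1)) *
        listPermanent (Finset.Ico (crossingSum n (j + 1)) (crossingSum n (j + 1 + t + 1)))
          (u :: chainColumns L D n c (j + 1) t) := by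
  have hj := hn j (by omega)
  have hs := crossingSum_succ n j
  have hle := crossingSum_add_le hn (i := j + 1) (t + 1) (by omega)
  rw [show j + 1 + (t + 1) = j + (t + 1) + 1 by omega] at hle
  rw [show j + 1 + t + 1 = j + (t + 1) + 1 by omega, chainColumns, ← listPermanent_block]
  · congr 1
    ext x
    simp only [Finset.mem_union, Finset.mem_Icc, Finset.mem_Ico]
    omega
  · intro r hr
    rw [Finset.mem_Ico] at hr
    omega
  · intro w hw r _ hr
    exact chainColumns_apply_eq_zero hc (by omega) (by omega) hw

theorem listPermanent_chainColumns_zero {L D : R} {n : ℕ → ℕ} {c : ℕ → ℕ → R} {j : ℕ}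
    (hj : 1 ≤ n j) (u : ℕ → R) :
    listPermanent (Finset.Ico (crossingSum n j) (crossingSum n (j + 0 + 1)))
        (u :: chainColumns L D n c j 0) =
      blockWeight L D (crossingSum n j) (n j - 1) u := by
  rw [← listPermanent_block_singleton, chainColumns, add_zero, crossingSum_succ]
  congr 1
  ext x
  simp only [Finset.mem_Icc, Finset.mem_Ico]
  omega

theorem listPermanent_chainColumns_of_joining {L D : R} {n : ℕ → ℕ} {c : ℕ → ℕ → R} {k : ℕ}
    (hn : ∀ j < k, 1 ≤ n j) (hc : ∀ j, j + 1 < k → ∀ r < crossingSum n j, c (j + 1) r = 0)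
    (hc' : ∀ j < k, 1 ≤ j → ∀ r, crossingSum n (j + 1) ≤ r → c j r = 0)
    {j t : ℕ} (hj : 1 ≤ j) (hjt : j + t < k) :
    listPermanent (Finset.Ico (crossingSum n j) (crossingSum n (j + t + 1)))
        (c j :: chainColumns L D n c j t) =
      ∏ i ∈ Finset.Ico j (j + t + 1), blockWeight L D (crossingSum n i) (n i - 1) (c i) := by
  induction t generalizing j with
  | zero =>
    rw [listPermanent_chainColumns_zero (hn j (by omega))]
    simp
  | succ t ih =>
    rw [listPermanent_chainColumns_succ hn hc hjt, ih (by omega) (by omega),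
      listPermanent_cons_eq_zero fun r hr => hc' j (by omega) hj r (Finset.mem_Ico.1 hr).1,
      mul_zero, add_zero, Finset.prod_eq_prod_Ico_succ_bot (by omega : j < j + (t + 1) + 1),
      show j + 1 + t + 1 = j + (t + 1) + 1 by omega]

theorem listPermanent_chainColumns {L D : R} {n : ℕ → ℕ} {c : ℕ → ℕ → R} {k : ℕ}
    (hn : ∀ j < k, 1 ≤ n j) (hc : ∀ j, j + 1 < k → ∀ r < crossingSum n j, c (j + 1) r = 0)
    (hc' : ∀ j < k, 1 ≤ j → ∀ r, crossingSum n (j + 1) ≤ r → c j r = 0)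
    {j t : ℕ} (hjt : j + t < k) (u : ℕ → R) :
    listPermanent (Finset.Ico (crossingSum n j) (crossingSum n (j + t + 1)))
        (u :: chainColumns L D n c j t) =
      ∑ i ∈ Finset.Ico j (j + t + 1), blockWeight L D (crossingSum n i) (n i - 1) u *
        (∏ b ∈ Finset.Ico j i, blockWeight L D (crossingSum n b) (n b - 1) (c (b + 1))) *
        ∏ b ∈ Finset.Ico (i + 1) (j + t + 1),
          blockWeight L D (crossingSum n b) (n b - 1) (c b) := by
  induction t generalizing j with
  | zero =>
    rw [listPermanent_chainColumns_zero (hn j (by omega))]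
    simp
  | succ t ih =>
    rw [listPermanent_chainColumns_succ hn hc hjt, ih (by omega),
      listPermanent_chainColumns_of_joining hn hc hc' (by omega) (by omega),
      Finset.sum_eq_sum_Ico_succ_bot (by omega : j < j + (t + 1) + 1),
      show j + 1 + t + 1 = j + (t + 1) + 1 by omega, Finset.mul_sum]
    congr 1
    · simp
    · refine Finset.sum_congr rfl fun i hi => ?_
      rw [Finset.prod_eq_prod_Ico_succ_bot (by have := Finset.mem_Ico.1 hi; omega : j < i)]
      ring

theorem chainColumns_perm (L D : R) (n : ℕ → ℕ) (c : ℕ → ℕ → R) (j t : ℕ) :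
    (chainColumns L D n c j t).Perm
      ((List.range' j (t + 1)).flatMap
          (fun i => pathColumns L D (crossingSum n i) (n i - 1)) ++
        (List.range' (j + 1) t).map c) := by
  induction t generalizing j with
  | zero => simp [chainColumns]
  | succ t ih =>
    rw [chainColumns, List.range'_succ, List.flatMap_cons, List.append_assoc,
      List.range'_succ, List.map_cons]
    exact ((ih (j + 1)).cons _ |>.trans List.perm_middle.symm).append_left _

end ListPermanent

open scoped Classical in
/-- The columns of `pretzelActivityMatrix`, as functions of a natural number. -/
noncomputable def pretzelColumn (k : ℕ) (n : ℕ → ℕ) (c r : ℕ) : MvPolynomial (Fin 4) ℤ :=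
    (if ∃ j < k, crossingSum n j ≤ (c : ℕ) + j ∧ (c : ℕ) + j + 1 < crossingSum n (j + 1) ∧
        (r : ℕ) = (c : ℕ) + j then X 0 else 0) +
    (if ∃ j < k, crossingSum n j ≤ (c : ℕ) + j ∧ (c : ℕ) + j + 1 < crossingSum n (j + 1) ∧
        (r : ℕ) = (c : ℕ) + j + 1 then X 1 else 0) +
    (if (c : ℕ) = crossingSum n k - k ∧ (r : ℕ) + 1 = crossingSum n 1 then X 0 else 0) +
    (if (c : ℕ) = crossingSum n k - k ∧ ∃ j, 1 ≤ j ∧ j < k ∧ (r : ℕ) = crossingSum n j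
        then X 1 else 0) +
    (if ∃ i, 1 ≤ i ∧ i < k ∧ (c : ℕ) = crossingSum n k - k + i ∧
        (r : ℕ) = crossingSum n (i - 1) then X 2 else 0) +
    (if ∃ i, 1 ≤ i ∧ i < k ∧ (c : ℕ) = crossingSum n k - k + i ∧
        crossingSum n (i - 1) < (r : ℕ) ∧ (r : ℕ) < crossingSum n (i + 1) then X 3 else 0)


theorem pretzelColumn_block {k : ℕ} {n : ℕ → ℕ} (hn : ∀ j < k, 1 ≤ n j) {j s : ℕ} (hj : j < k)
    (hs : s < n j - 1) :
    pretzelColumn k n (crossingSum n j - j + s) = fun r =>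
      if r = crossingSum n j + s then X 0 else if r = crossingSum n j + s + 1 then X 1 else 0 := by
  have hle : j ≤ crossingSum n j := by
    have := crossingSum_add_le hn (i := 0) j (by omega)
    rw [zero_add] at this
    omega
  have hsucc := crossingSum_succ n j
  have hlast := crossingSum_add_le hn (i := j + 1) (k - (j + 1)) (by omega)
  rw [show j + 1 + (k - (j + 1)) = k by omega] at hlast
  have huniq : ∀ i < k, crossingSum n i ≤ crossingSum n j - j + s + i →
      crossingSum n j - j + s + i + 1 < crossingSum n (i + 1) → i = j := by
    intro i hi h₁ h₂
    rcases lt_trichotomy i j with h | h | h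
    · have := crossingSum_add_le hn (i := i + 1) (j - (i + 1)) (by omega)
      rw [show i + 1 + (j - (i + 1)) = j by omega] at this
      omega
    · exact h
    · have := crossingSum_add_le hn (i := j + 1) (i - (j + 1)) (by omega)
      rw [show j + 1 + (i - (j + 1)) = i by omega] at this
      omega
  funext r
  have hne : ∀ i, crossingSum n j - j + s ≠ crossingSum n k - k + i := fun i => by omega
  have hne₀ : crossingSum n j - j + s ≠ crossingSum n k - k := hne 0
  have hL : (∃ i < k, crossingSum n i ≤ crossingSum n j - j + s + i ∧
      crossingSum n j - j + s + i + 1 < crossingSum n (i + 1) ∧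
        r = crossingSum n j - j + s + i) ↔ r = crossingSum n j + s := by
    constructor
    · rintro ⟨i, hi, h₁, h₂, rfl⟩
      obtain rfl := huniq i hi h₁ h₂
      omega
    · exact fun h => ⟨j, hj, by omega, by omega, by omega⟩
  have hD : (∃ i < k, crossingSum n i ≤ crossingSum n j - j + s + i ∧
      crossingSum n j - j + s + i + 1 < crossingSum n (i + 1) ∧
        r = crossingSum n j - j + s + i + 1) ↔ r = crossingSum n j + s + 1 := by
    clear hL
    constructor
    · rintro ⟨i, hi, h₁, h₂, rfl⟩
      obtain rfl := huniq i hi h₁ h₂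
      omega
    · exact fun h => ⟨j, hj, by omega, by omega, by omega⟩
  simp only [pretzelColumn, hL, hD, hne, hne₀, false_and, and_false, exists_const, if_false,
    add_zero]
  clear hL hD
  split_ifs
  · omega
  · rw [add_zero]
  · rw [zero_add]
  · rw [add_zero]

theorem not_block_of_le {k : ℕ} {n : ℕ → ℕ} (hn : ∀ j < k, 1 ≤ n j) {c j : ℕ} (hj : j < k)
    (hc : crossingSum n k - k ≤ c) : ¬ c + j + 1 < crossingSum n (j + 1) := by
  have := crossingSum_add_le hn (i := j + 1) (k - (j + 1)) (by omega)
  rw [show j + 1 + (k - (j + 1)) = k by omega] at this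
  omega

open scoped Classical in
theorem pretzelColumn_zero {k : ℕ} {n : ℕ → ℕ} (hn : ∀ j < k, 1 ≤ n j) (r : ℕ) :
    pretzelColumn k n (crossingSum n k - k + 0) r =
      (if r + 1 = crossingSum n 1 then X 0 else 0) +
        if ∃ j, 1 ≤ j ∧ j < k ∧ r = crossingSum n j then X 1 else 0 := by
  have hblock : ∀ j < k, ¬ crossingSum n k - k + j + 1 < crossingSum n (j + 1) :=
    fun j hj => not_block_of_le hn hj le_rfl
  rw [pretzelColumn, if_neg, if_neg, if_neg (c := ∃ i, 1 ≤ i ∧ i < k ∧ _ ∧ r = _),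
    if_neg (c := ∃ i, 1 ≤ i ∧ i < k ∧ _ ∧ _ < r ∧ _)]
  · simp
  · rintro ⟨i, hi, -, h, -⟩
    omega
  · rintro ⟨i, hi, -, h, -⟩
    omega
  · rintro ⟨j, hj, -, h, -⟩
    exact hblock j hj h
  · rintro ⟨j, hj, -, h, -⟩
    exact hblock j hj h

open scoped Classical in
theorem pretzelColumn_joining {k : ℕ} {n : ℕ → ℕ} (hn : ∀ j < k, 1 ≤ n j) {i : ℕ} (hi : 1 ≤ i)
    (hik : i < k) (r : ℕ) :
    pretzelColumn k n (crossingSum n k - k + i) r =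
      (if r = crossingSum n (i - 1) then X 2 else 0) +
        if crossingSum n (i - 1) < r ∧ r < crossingSum n (i + 1) then X 3 else 0 := by
  have hblock : ∀ j < k, ¬ crossingSum n k - k + i + j + 1 < crossingSum n (j + 1) :=
    fun j hj => not_block_of_le hn hj (by omega)
  rw [pretzelColumn, if_neg, if_neg, if_neg, if_neg, zero_add, zero_add, zero_add, zero_add]
  · congr 1
    · refine if_congr ⟨?_, fun h => ⟨i, hi, hik, rfl, h⟩⟩ rfl rfl
      rintro ⟨j, -, -, h, h'⟩
      obtain rfl : i = j := by omega
      exact h'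
    · refine if_congr ⟨?_, fun h => ⟨i, hi, hik, rfl, h⟩⟩ rfl rfl
      rintro ⟨j, -, -, h, h'⟩
      obtain rfl : i = j := by omega
      exact h'
  · rintro ⟨h, -⟩
    omega
  · rintro ⟨h, -⟩
    omega
  · rintro ⟨j, hj, -, h, -⟩
    exact hblock j hj h
  · rintro ⟨j, hj, -, h, -⟩
    exact hblock j hj h

theorem map_pretzelColumn_range {k : ℕ} {n : ℕ → ℕ} (hn : ∀ j < k, 1 ≤ n j) {j : ℕ} (hj : j ≤ k) :
    (List.range (crossingSum n j - j)).map (pretzelColumn k n) =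
      (List.range j).flatMap fun i => pathColumns (X 0) (X 1) (crossingSum n i) (n i - 1) := by
  induction j with
  | zero => simp [crossingSum]
  | succ j ih =>
    have hle := crossingSum_add_le hn (i := 0) j (by omega)
    rw [zero_add] at hle
    have := hn j (by omega)
    rw [crossingSum_succ, show crossingSum n j + n j - (j + 1) =
        crossingSum n j - j + (n j - 1) by omega, List.range_add, List.map_append,
      ih (by omega), List.range_succ, List.flatMap_append, List.flatMap_singleton, List.map_map]
    congr 1
    refine List.map_congr_left fun s hs => ?_
    exact pretzelColumn_block hn (by omega) (List.mem_range.1 hs)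

theorem map_pretzelColumn_perm {k : ℕ} {n : ℕ → ℕ} (hk : 1 ≤ k) (hn : ∀ j < k, 1 ≤ n j) :
    ((List.range (crossingSum n k)).map (pretzelColumn k n)).Perm
      (pretzelColumn k n (crossingSum n k - k + 0) ::
        chainColumns (X 0) (X 1) n (fun i => pretzelColumn k n (crossingSum n k - k + i))
          0 (k - 1)) := by
  have hle := crossingSum_add_le hn (i := 0) k (by omega)
  rw [zero_add] at hle
  obtain ⟨t, rfl⟩ : ∃ t, k = t + 1 := ⟨k - 1, by omega⟩
  have h : (List.range (crossingSum n (t + 1))).map (pretzelColumn (t + 1) n) =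
      (List.range (crossingSum n (t + 1) - (t + 1))).map (pretzelColumn (t + 1) n) ++
        (List.range (t + 1)).map
          fun i => pretzelColumn (t + 1) n (crossingSum n (t + 1) - (t + 1) + i) := by
    conv_lhs => rw [show crossingSum n (t + 1) =
      crossingSum n (t + 1) - (t + 1) + (t + 1) by omega, List.range_add]
    rw [List.map_append, List.map_map]
    rfl
  rw [h, map_pretzelColumn_range hn le_rfl, List.range_eq_range',
    List.range'_succ (n := t), List.map_cons]
  refine List.perm_middle.trans (List.Perm.cons _ ?_)
  rw [← List.range'_succ]
  exact (chainColumns_perm _ _ _ _ _ _).symm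

theorem blockWeight_pretzelColumn_zero_first {k : ℕ} {n : ℕ → ℕ} (hk : 1 ≤ k)
    (hn : ∀ j < k, 1 ≤ n j) :
    blockWeight (X 0) (X 1) (crossingSum n 0) (n 0 - 1)
      (pretzelColumn k n (crossingSum n k - k + 0)) = X 0 ^ n 0 := by
  have h0 := hn 0 (by omega)
  have hN0 : crossingSum n 0 = 0 := by simp [crossingSum]
  have hN1 : crossingSum n 1 = n 0 := by simp [crossingSum]
  rw [blockWeight, Finset.sum_eq_single (n 0 - 1)]
  · rw [pretzelColumn_zero hn, if_pos (by omega), if_neg, add_zero, Nat.sub_self, pow_zero,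
      mul_one, ← pow_succ, Nat.sub_add_cancel h0]
    rintro ⟨j, hj, hjk, h⟩
    have := crossingSum_add_le hn (i := 1) (j - 1) (by omega)
    rw [show 1 + (j - 1) = j by omega] at this
    omega
  · intro s hs hne
    have hs := Finset.mem_range.1 hs
    rw [pretzelColumn_zero hn, if_neg (by omega), if_neg, add_zero, mul_zero]
    rintro ⟨j, hj, hjk, h⟩
    have := crossingSum_add_le hn (i := 1) (j - 1) (by omega)
    rw [show 1 + (j - 1) = j by omega] at this
    omega
  · intro h
    simp at h

theorem blockWeight_pretzelColumn_zero {k : ℕ} {n : ℕ → ℕ} (hn : ∀ j < k, 1 ≤ n j) {j : ℕ}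
    (hj : 1 ≤ j) (hjk : j < k) :
    blockWeight (X 0) (X 1) (crossingSum n j) (n j - 1)
      (pretzelColumn k n (crossingSum n k - k + 0)) = X 1 ^ n j := by
  have hnj := hn j hjk
  have hsucc := crossingSum_succ n j
  have hN1 := crossingSum_add_le hn (i := 1) (j - 1) (by omega)
  rw [show 1 + (j - 1) = j by omega] at hN1
  rw [blockWeight, Finset.sum_eq_single 0]
  · rw [pretzelColumn_zero hn, if_neg (by omega), if_pos ⟨j, hj, hjk, rfl⟩, zero_add, pow_zero,
      one_mul, Nat.sub_zero, ← pow_succ, Nat.sub_add_cancel hnj]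
  · intro s hs hne
    have hs := Finset.mem_range.1 hs
    rw [pretzelColumn_zero hn, if_neg (by omega), if_neg, add_zero, mul_zero]
    rintro ⟨i, hi, hik, h⟩
    rcases le_or_gt i j with hij | hij
    · have := crossingSum_add_le hn (i := i) (j - i) (by omega)
      rw [show i + (j - i) = j by omega] at this
      omega
    · have := crossingSum_add_le hn (i := j + 1) (i - (j + 1)) (by omega)
      rw [show j + 1 + (i - (j + 1)) = i by omega] at this
      omega
  · intro h
    simp at h

theorem blockWeight_pretzelColumn_self {k : ℕ} {n : ℕ → ℕ} (hn : ∀ j < k, 1 ≤ n j) {j : ℕ}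
    (hj : 1 ≤ j) (hjk : j < k) :
    blockWeight (X 0) (X 1) (crossingSum n j) (n j - 1)
      (pretzelColumn k n (crossingSum n k - k + j)) = pretzelE n j := by
  have hnj := hn j hjk
  have hsucc := crossingSum_succ n j
  have hprev := crossingSum_add_le hn (i := j - 1) 1 (by omega)
  rw [show j - 1 + 1 = j by omega] at hprev
  rw [blockWeight, pretzelE, Nat.sub_add_cancel hnj]
  refine Finset.sum_congr rfl fun s hs => ?_
  have hs := Finset.mem_range.1 hs
  rw [pretzelColumn_joining hn hj hjk, if_neg (by omega), if_pos (by omega)]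
  ring

theorem blockWeight_pretzelColumn_succ {k : ℕ} {n : ℕ → ℕ} (hn : ∀ j < k, 1 ≤ n j) {j : ℕ}
    (hjk : j + 1 < k) :
    blockWeight (X 0) (X 1) (crossingSum n j) (n j - 1)
      (pretzelColumn k n (crossingSum n k - k + (j + 1))) =
        X 2 * X 1 ^ (n j - 1) + pretzelF n j := by
  have hnj := hn j (by omega)
  have hsucc := crossingSum_succ n j
  have hsucc' := crossingSum_succ n (j + 1)
  rw [blockWeight, pretzelF, Nat.sub_add_cancel hnj, Finset.range_eq_Ico,
    Finset.sum_eq_sum_Ico_succ_bot (by omega)]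
  refine congrArg₂ (· + ·) ?_ ?_
  · rw [pretzelColumn_joining hn (by omega) hjk, if_pos (by simp), if_neg (by simp)]
    rw [pow_zero, one_mul, Nat.sub_zero, add_zero, mul_comm]
  · refine Finset.sum_congr rfl fun s hs => ?_
    have hs := Finset.mem_Ico.1 hs
    rw [pretzelColumn_joining hn (by omega) hjk, Nat.add_sub_cancel, if_neg (by omega),
      if_pos (by omega)]
    ring

/-- The permanent of the unenhanced activity matrix of the
all-positive pretzel link `P(n 1, …, n k)` equals
`L^{n 1} Π_{j=2}^{k} E j + Σ_{i=2}^{k} D^{n i} Π_{j=1}^{i-1} (ℓ D^{n j - 1} + F j) Π_{j=i+1}^{k} E j`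
(indices written `0`-based below). -/
theorem permanent_pretzelActivityMatrix (k : ℕ) (hk : 2 ≤ k) (n : ℕ → ℕ)
    (hn : ∀ j < k, 1 ≤ n j) :
    (pretzelActivityMatrix k n).permanent =
      X 0 ^ (n 0) * ∏ j ∈ Finset.Ico 1 k, pretzelE n j +
        ∑ i ∈ Finset.Ico 1 k,
          X 1 ^ (n i) *
            (∏ j ∈ Finset.range i, (X 2 * X 1 ^ (n j - 1) + pretzelF n j)) *
            ∏ j ∈ Finset.Ico (i + 1) k, pretzelE n j := by
  have hN0 : crossingSum n 0 = 0 := by simp [crossingSum]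
  have hmatrix : pretzelActivityMatrix k n =
      fun r c : Fin (crossingSum n k) => pretzelColumn k n c r := rfl
  have hexpand := listPermanent_chainColumns (L := X 0) (D := X 1) (n := n)
    (c := fun i => pretzelColumn k n (crossingSum n k - k + i)) (k := k) hn ?_ ?_
    (j := 0) (t := k - 1) (by omega) (pretzelColumn k n (crossingSum n k - k + 0))
  · rw [hN0, show 0 + (k - 1) + 1 = k by omega, ← Finset.range_eq_Ico] at hexpand
    rw [hmatrix, permanent_eq_listPermanent,
      listPermanent_perm (map_pretzelColumn_perm (by omega) hn), hexpand,
      Finset.sum_eq_sum_Ico_succ_bot (by omega), blockWeight_pretzelColumn_zero_first (by omega) hn]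
    refine congrArg₂ (· + ·) ?_ ?_
    · rw [Finset.Ico_self, Finset.prod_empty, mul_one]
      refine congrArg _ (Finset.prod_congr rfl fun b hb => ?_)
      have hb := Finset.mem_Ico.1 hb
      exact blockWeight_pretzelColumn_self hn (by omega) hb.2
    · refine Finset.sum_congr rfl fun i hi => ?_
      have hi := Finset.mem_Ico.1 hi
      rw [blockWeight_pretzelColumn_zero hn (by omega) hi.2, Finset.range_eq_Ico]
      refine congrArg₂ (· * ·) ?_ ?_
      · refine congrArg _ (Finset.prod_congr rfl fun b hb => ?_)
        have hb := Finset.mem_Ico.1 hb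
        exact blockWeight_pretzelColumn_succ hn (by omega)
      · refine Finset.prod_congr rfl fun b hb => ?_
        have hb := Finset.mem_Ico.1 hb
        exact blockWeight_pretzelColumn_self hn (by omega) hb.2
  · intro j hj r hr
    simp only [pretzelColumn_joining hn (by omega : 1 ≤ j + 1) hj, Nat.add_sub_cancel]
    rw [if_neg (by omega), if_neg (by omega), add_zero]
  · intro j hj hj' r hr
    have h₁ := crossingSum_succ n (j - 1)
    have h₂ := crossingSum_succ n j
    have := hn j hj
    rw [show j - 1 + 1 = j by omega] at h₁
    simp only [pretzelColumn_joining hn hj' hj]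
    rw [if_neg (by omega), if_neg (by omega), add_zero]
end

section
/- Let G be a finite connected simple graph on a vertex set V with |V| = m + 1 ≥ 2, let v₀ ∈ V, and let T be a set of m edges of G. Then the m × m matrix over ℤ/2ℤ whose rows are indexed by T, whose columns are indexed by V \ {v₀}, and whose (e, w) entry is 1 if the vertex w is incident with the edge e and 0 otherwise, is invertible if and only if the spanning subgraph of G with edge set T is a spanning tree of G. -/
/-- The sum of a function vanishing at `v₀` over the endpoints other than `v₀` of an edge is
the sum of its values at both endpoints. -/
lemma sum_ite_mem_mk_mul_eq_add {V R : Type*} [NonAssocSemiring R] (v₀ : V)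
    [Fintype {w : V // w ≠ v₀}] {a b : V} (hab : a ≠ b)
    [∀ w : {w : V // w ≠ v₀}, Decidable ((w : V) ∈ s(a, b))]
    (F : V → R) (hF : F v₀ = 0) :
    ∑ w : {w : V // w ≠ v₀}, (if (w : V) ∈ s(a, b) then (1 : R) else 0) * F w = F a + F b := by
  classical
  have key (c : V) : ∑ w : {w : V // w ≠ v₀}, (if (w : V) = c then F w else 0) = F c := by
    by_cases hc : c = v₀
    · subst hc
      rw [hF]
      exact Finset.sum_eq_zero fun w _ => by simp [w.2]
    · rw [Finset.sum_eq_single ⟨c, hc⟩ (fun w _ hw => if_neg fun h => hw (Subtype.ext h))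
        (by simp)]
      simp
  rw [← key a, ← key b, ← Finset.sum_add_distrib]
  refine Finset.sum_congr rfl fun w _ => ?_
  by_cases ha : (w : V) = a <;> by_cases hb : (w : V) = b <;> simp_all [Sym2.mem_iff]

/-- A graph is connected iff every function over `ℤ/2ℤ` that vanishes at a fixed vertex and is
constant along edges is zero. -/
lemma SimpleGraph.connected_iff_forall_eq_zero {V : Type*} (H : SimpleGraph V) (v₀ : V) :
    H.Connected ↔ ∀ F : V → ZMod 2, F v₀ = 0 → (∀ a b, H.Adj a b → F a + F b = 0) → F = 0 := by
  classical
  constructor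
  · intro hH F hF hadj
    funext v
    obtain ⟨p⟩ := hH.preconnected v v₀
    induction p with
    | nil => exact hF
    | cons h _ ih =>
      have h_sum := hadj _ _ h
      rwa [ih hF, Pi.zero_apply, add_zero] at h_sum
  · intro h
    have hF := h (fun v => if H.Reachable v₀ v then 0 else 1) (by simp) fun a b hab => by
      have : H.Reachable v₀ a ↔ H.Reachable v₀ b :=
        ⟨fun h => h.trans hab.reachable, fun h => h.trans hab.symm.reachable⟩
      by_cases hb : H.Reachable v₀ b
      · simp [this, hb]
      · simpa [this, hb] using CharTwo.add_self_eq_zero (1 : ZMod 2)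
    have hreach (v : V) : H.Reachable v₀ v := by
      by_contra hv
      simpa [hv] using congrFun hF v
    exact SimpleGraph.connected_iff_exists_forall_reachable _ |>.2 ⟨v₀, hreach⟩

open scoped Classical in
/-- Let `G` be a finite connected simple graph on `m + 1 ≥ 2`
vertices, let `v₀` be a vertex and let `T` be a set of `m` edges of `G`.  The `m × m`
matrix over `ℤ/2ℤ` with rows indexed by `T` and columns indexed by `V \ {v₀}` whose
`(e, w)` entry is `1` iff `w` is incident with `e` is invertible (i.e. the associated
linear map is bijective) iff `T` is (the edge set of) a spanning tree of `G`. -/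
theorem truncated_incidence_matrix_invertible_iff_spanning_tree
    {V : Type*} [Fintype V] [DecidableEq V]
    (G : SimpleGraph V) (hG : G.Connected)
    (m : ℕ) (hm : 1 ≤ m) (hcard : Fintype.card V = m + 1)
    (v₀ : V) (T : Finset (Sym2 V)) (hTE : ∀ e ∈ T, e ∈ G.edgeSet)
    (hTcard : T.card = m) :
    Function.Bijective
        (Matrix.mulVecLin
          (fun (e : ↥T) (w : {w : V // w ≠ v₀}) =>
            if (w : V) ∈ (e : Sym2 V) then (1 : ZMod 2) else 0)) ↔
      IsSpanningTree G (↑T : Set (Sym2 V)) := by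
  have hne : ∀ a b, s(a, b) ∈ T → a ≠ b := fun a b h =>
    ((SimpleGraph.mem_edgeSet G).1 (hTE _ h)).ne
  have hadj (a b : V) :
      (SimpleGraph.fromEdgeSet (T : Set (Sym2 V))).Adj a b ↔ s(a, b) ∈ T := by
    rw [SimpleGraph.fromEdgeSet_adj, Finset.mem_coe]
    exact ⟨And.left, fun h => ⟨h, hne a b h⟩⟩
  have hedge : (SimpleGraph.fromEdgeSet (T : Set (Sym2 V))).edgeSet = T := by
    ext e
    induction e with
    | h a b => rw [SimpleGraph.mem_edgeSet, hadj, Finset.mem_coe]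
  have htree : IsSpanningTree G (T : Set (Sym2 V)) ↔
      (SimpleGraph.fromEdgeSet (T : Set (Sym2 V))).Connected := by
    rw [IsSpanningTree, SimpleGraph.isTree_iff_connected_and_card, hedge,
      Nat.card_eq_fintype_card, Nat.card_eq_fintype_card, hcard]
    simp [hTcard, Set.subset_def]
    exact fun _ => hTE
  have hdim : Module.finrank (ZMod 2) ({w : V // w ≠ v₀} → ZMod 2) =
      Module.finrank (ZMod 2) (↥T → ZMod 2) := by
    simp [Module.finrank_fintype_fun_eq_card, hcard, hTcard]
  rw [htree, SimpleGraph.connected_iff_forall_eq_zero _ v₀, Function.Bijective,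
    ← LinearMap.injective_iff_surjective_of_finrank_eq_finrank hdim, and_self,
    injective_iff_map_eq_zero]
  constructor
  · intro h F hF hF_adj
    have h_restrict := h (fun w => F w) <| by
      funext ⟨e, he⟩
      induction e with
      | h a b =>
        exact (sum_ite_mem_mk_mul_eq_add v₀ (hne a b he) F hF).trans
          (hF_adj a b ((hadj a b).2 he))
    funext v
    by_cases hv : v = v₀
    · rw [hv, hF, Pi.zero_apply]
    · exact congrFun h_restrict ⟨v, hv⟩
  · intro h f hf
    let F : V → ZMod 2 := fun v => if hv : v ≠ v₀ then f ⟨v, hv⟩ else 0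
    have hF : F v₀ = 0 := by simp [F]
    have hFf (w : {w : V // w ≠ v₀}) : F w = f w := dif_pos w.2
    have hF_zero := h F hF fun a b hab => by
      have he := (hadj a b).1 hab
      rw [← sum_ite_mem_mk_mul_eq_add v₀ (hne a b he) F hF]
      simp only [hFf]
      exact congrFun hf ⟨s(a, b), he⟩
    funext w
    rw [← hFf, hF_zero, Pi.zero_apply, Pi.zero_apply]
end

section
/- Let G be a finite connected simple graph whose edge set carries a linear order, let e = {x, y} be the maximum edge, and assume e is not a bridge of G. Let G' be the graph obtained from G by subdividing e: add a new vertex w, delete e, and add new edges e' = {x, w} and e'' = {w, y}, with the linear order on the edges of G' extending the order on the edges of G \ {e} and with e' < e'' the two largest edges. Then the spanning trees of G' are exactly: (i) (S \ {e}) ∪ {e', e''} for each spanning tree S of G containing e; (ii) S ∪ {e''} for each spanning tree S of G not containing e; and (iii) S ∪ {e'} for each spanning tree S of G not containing e. Moreover, every edge f of G other than e has the same activity status (internally/externally active or inactive) with respect to the corresponding trees of G and G', and the new edges satisfy: in case (i), e' and e'' are both internally inactive; in case (ii), e' is externally inactive and e'' is internally inactive; and in case (iii), e' is internally active and e'' is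 externally inactive. -/
/-- Two edges (in possibly different graphs, with possibly different edge orders) have
the same activity status if each of the four activity statuses holds for one iff it
holds for the other. -/
def SameActivityStatus {V W : Type*} [LinearOrder (Sym2 V)] [LinearOrder (Sym2 W)]
    (G : SimpleGraph V) (S : Set (Sym2 V)) (f : Sym2 V)
    (G' : SimpleGraph W) (S' : Set (Sym2 W)) (f' : Sym2 W) : Prop :=
  (InternallyActive G S f ↔ InternallyActive G' S' f') ∧
  (InternallyInactive G S f ↔ InternallyInactive G' S' f') ∧
  (ExternallyActive G S f ↔ ExternallyActive G' S' f') ∧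
  (ExternallyInactive G S f ↔ ExternallyInactive G' S' f')

/-- The image of an edge of `G` in the subdivided graph on `V ⊕ Unit`. -/
def liftEdge {V : Type*} : Sym2 V → Sym2 (V ⊕ Unit) :=
  Sym2.map (Sum.inl : V → V ⊕ Unit)

section SpanningTree

variable {V : Type*} {G : SimpleGraph V} {S : Set (Sym2 V)} {f g : Sym2 V}

lemma edgeSet_fromEdgeSet_of_subset (hS : S ⊆ G.edgeSet) :
    (SimpleGraph.fromEdgeSet S).edgeSet = S := by
  rw [SimpleGraph.edgeSet_fromEdgeSet, sdiff_eq_left, ← Set.subset_compl_iff_disjoint_right]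
  exact hS.trans G.edgeSet_subset_compl_diagSet

lemma isSpanningTree_iff_connected_and_ncard [Finite V] :
    IsSpanningTree G S ↔
      S ⊆ G.edgeSet ∧ (SimpleGraph.fromEdgeSet S).Connected ∧ S.ncard + 1 = Nat.card V := by
  refine and_congr_right fun hS => ?_
  rw [SimpleGraph.isTree_iff_connected_and_card, edgeSet_fromEdgeSet_of_subset hS,
    Nat.card_coe_set_eq]

lemma ncard_insert_sdiff_singleton [Finite V] (hf : f ∉ S) (hg : g ∈ S) :
    (insert f (S \ {g})).ncard = S.ncard := by
  have := Set.ncard_sdiff_singleton_add_one hg (Set.toFinite S)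
  rw [Set.ncard_insert_of_notMem (by simp [hf]) (Set.toFinite _), this]

/-- The edges of the fundamental cycle of `f` are those that can be exchanged for `f`. -/
lemma IsSpanningTree.exists_isCycle_iff [Finite V] (hS : IsSpanningTree G S)
    (hf : f ∈ G.edgeSet) (hfS : f ∉ S) (hg : g ∈ S) :
    (∃ (v : V) (c : (SimpleGraph.fromEdgeSet (insert f S)).Walk v v),
      c.IsCycle ∧ g ∈ c.edges) ↔ IsSpanningTree G (insert f (S \ {g})) := by
  have hsub : insert f S ⊆ G.edgeSet := Set.insert_subset hf hS.1
  have hne : f ≠ g := fun h => hfS (h ▸ hg)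
  have hconn : (SimpleGraph.fromEdgeSet (insert f S)).Connected :=
    hS.2.connected.mono (SimpleGraph.fromEdgeSet_mono (Set.subset_insert _ _))
  have hdel : (SimpleGraph.fromEdgeSet (insert f S)).deleteEdges {g} =
      SimpleGraph.fromEdgeSet (insert f (S \ {g})) := by
    ext a b
    simp only [SimpleGraph.deleteEdges_adj, SimpleGraph.fromEdgeSet_adj, Set.mem_insert_iff,
      Set.mem_sdiff, Set.mem_singleton_iff]
    grind
  have hbridge := SimpleGraph.isBridge_iff_forall_cycle_notMem
    (G := SimpleGraph.fromEdgeSet (insert f S)) (e := g)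
    (by rw [edgeSet_fromEdgeSet_of_subset hsub]; exact Or.inr hg)
  have hcycle : (∃ (v : V) (c : (SimpleGraph.fromEdgeSet (insert f S)).Walk v v),
      c.IsCycle ∧ g ∈ c.edges) ↔ ¬ (SimpleGraph.fromEdgeSet (insert f S)).IsBridge g := by
    rw [hbridge]; push Not; rfl
  rw [hcycle, isSpanningTree_iff_connected_and_ncard, ncard_insert_sdiff_singleton hfS hg, ← hdel]
  constructor
  · intro h
    refine ⟨Set.insert_subset hf (Set.sdiff_subset.trans hS.1), ?_,
      (isSpanningTree_iff_connected_and_ncard.1 hS).2.2⟩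
    induction g with
    | h a b => exact hconn.connected_delete_edge_of_not_isBridge h
  · rintro ⟨-, h, -⟩
    induction g with
    | h a b => exact fun hb => hb (h.preconnected a b)

lemma IsSpanningTree.exists_exchange_of_notMem [Finite V] (hS : IsSpanningTree G S)
    (hf : f ∈ G.edgeSet) (hfS : f ∉ S) : ∃ g ∈ S, IsSpanningTree G (insert f (S \ {g})) := by
  have hsub : insert f S ⊆ G.edgeSet := Set.insert_subset hf hS.1
  have hcard := (isSpanningTree_iff_connected_and_ncard.1 hS).2.2
  have hnot : ¬ IsSpanningTree G (insert f S) := by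
    rw [isSpanningTree_iff_connected_and_ncard, Set.ncard_insert_of_notMem hfS (Set.toFinite S)]
    omega
  have hcyc : ¬ (SimpleGraph.fromEdgeSet (insert f S)).IsAcyclic := fun h =>
    hnot ⟨hsub, hS.2.connected.mono (SimpleGraph.fromEdgeSet_mono (Set.subset_insert _ _)), h⟩
  simp only [SimpleGraph.IsAcyclic, not_forall, not_not] at hcyc
  obtain ⟨v, c, hc⟩ := hcyc
  obtain ⟨g, hgc, hgf⟩ : ∃ g ∈ c.edges, g ≠ f := by
    by_contra! h
    have hle : c.edges.length ≤ 1 := by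
      rw [List.eq_replicate_of_mem h]
      have := hc.isTrail.edges_nodup
      rw [List.eq_replicate_of_mem h, List.nodup_replicate] at this
      simpa using this
    have := hc.three_le_length
    rw [SimpleGraph.Walk.length_edges] at hle
    omega
  have hgS : g ∈ S := by
    have := c.edges_subset_edgeSet hgc
    rw [edgeSet_fromEdgeSet_of_subset hsub] at this
    exact this.resolve_left hgf
  exact ⟨g, hgS, (hS.exists_isCycle_iff hf hfS hgS).1 ⟨v, c, hc, hgc⟩⟩

lemma IsSpanningTree.exists_exchange_of_mem [Finite V] (hS : IsSpanningTree G S)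
    (hf : f ∈ S) (hconn : (G.deleteEdges {f}).Connected) :
    ∃ g ∈ G.edgeSet, g ∉ S ∧ IsSpanningTree G (insert g (S \ {f})) := by
  have hsub : S \ {f} ⊆ G.edgeSet := Set.sdiff_subset.trans hS.1
  have hle : SimpleGraph.fromEdgeSet (S \ {f}) ≤ G.deleteEdges {f} := by
    rw [← SimpleGraph.edgeSet_subset_edgeSet, edgeSet_fromEdgeSet_of_subset hsub,
      SimpleGraph.edgeSet_deleteEdges]
    exact Set.sdiff_subset_sdiff_left hS.1
  obtain ⟨T, hST, hTG, hT⟩ := hconn.exists_isTree_le_of_le_of_isAcyclic hle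
    (hS.2.isAcyclic.anti (SimpleGraph.fromEdgeSet_mono Set.sdiff_subset))
  rw [← SimpleGraph.edgeSet_subset_edgeSet, edgeSet_fromEdgeSet_of_subset hsub] at hST
  rw [← SimpleGraph.edgeSet_subset_edgeSet, SimpleGraph.edgeSet_deleteEdges] at hTG
  have hTS : IsSpanningTree G T.edgeSet :=
    ⟨hTG.trans Set.sdiff_subset, by rwa [SimpleGraph.fromEdgeSet_edgeSet]⟩
  have h1 := (isSpanningTree_iff_connected_and_ncard.1 hTS).2.2
  have h2 := (isSpanningTree_iff_connected_and_ncard.1 hS).2.2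
  have h3 := Set.ncard_sdiff_singleton_add_one hf (Set.toFinite S)
  have h4 := Set.ncard_sdiff_add_ncard_of_subset hST (Set.toFinite _)
  obtain ⟨g, hg⟩ := Set.ncard_eq_one.1 (show (T.edgeSet \ (S \ {f})).ncard = 1 by omega)
  have hgT : g ∈ T.edgeSet \ (S \ {f}) := hg ▸ Set.mem_singleton g
  have hgG := hTG hgT.1
  refine ⟨g, hgG.1, fun h => hgT.2 ⟨h, hgG.2⟩, ?_⟩
  rwa [Set.insert_eq, ← hg, Set.sdiff_union_of_subset hST]

lemma IsSpanningTree.externallyActive_iff [Finite V] [LinearOrder (Sym2 V)]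
    (hS : IsSpanningTree G S) :
    ExternallyActive G S f ↔ f ∈ G.edgeSet ∧ f ∉ S ∧
      ∀ g ∈ S, IsSpanningTree G (insert f (S \ {g})) → f ≤ g := by
  refine and_congr_right fun hf => and_congr_right fun hfS => ?_
  constructor
  · intro h g hg hex
    obtain ⟨v, c, hc, hgc⟩ := (hS.exists_isCycle_iff hf hfS hg).2 hex
    exact h v c hc g hgc
  · intro h v c hc g hgc
    have := c.edges_subset_edgeSet hgc
    rw [edgeSet_fromEdgeSet_of_subset (Set.insert_subset hf hS.1)] at this
    obtain rfl | hg := this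
    · exact le_rfl
    · exact h g hg ((hS.exists_isCycle_iff hf hfS hg).1 ⟨v, c, hc, hgc⟩)

end SpanningTree

section Subdivision

variable {V : Type*}

lemma SimpleGraph.Reachable.of_forall_adj {W : Type*} {H : SimpleGraph V} {H' : SimpleGraph W}
    {φ : V → W} (hφ : ∀ u v, H.Adj u v → H'.Reachable (φ u) (φ v)) {u v : V}
    (h : H.Reachable u v) : H'.Reachable (φ u) (φ v) := by
  obtain ⟨p⟩ := h
  induction p with
  | nil => exact .refl _
  | cons hadj _ ih => exact (hφ _ _ hadj).trans ih

lemma liftEdge_injective : Function.Injective (liftEdge : Sym2 V → Sym2 (V ⊕ Unit)) :=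
  Sym2.map.injective Sum.inl_injective

lemma liftEdge_ne (f : Sym2 V) (a : V ⊕ Unit) : liftEdge f ≠ s(a, Sum.inr ()) := by
  intro h
  have : Sum.inr () ∈ liftEdge f := h ▸ Sym2.mem_mk_right _ _
  simp [liftEdge, Sym2.mem_map] at this

lemma liftEdge_mem_image_union_iff {S : Set (Sym2 V)} {B : Set (Sym2 (V ⊕ Unit))} {f : Sym2 V}
    (hB : liftEdge f ∉ B) : liftEdge f ∈ liftEdge '' S ∪ B ↔ f ∈ S := by
  rw [Set.mem_union, or_iff_left hB, liftEdge_injective.mem_set_image]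

lemma liftEdge_image_insert_sdiff_union {S : Set (Sym2 V)} {B : Set (Sym2 (V ⊕ Unit))}
    {f g : Sym2 V} (hB : liftEdge f ∉ B) :
    insert (liftEdge g) ((liftEdge '' S ∪ B) \ {liftEdge f}) =
      liftEdge '' insert g (S \ {f}) ∪ B := by
  rw [Set.image_insert_eq, Set.image_sdiff liftEdge_injective, Set.image_singleton,
    Set.union_sdiff_distrib, Set.sdiff_singleton_eq_self hB, Set.insert_union]

lemma ncard_liftEdge_image_union [Finite V] {S : Set (Sym2 V)} {B : Set (Sym2 (V ⊕ Unit))}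
    (hB : ∀ f, liftEdge f ∉ B) : (liftEdge '' S ∪ B).ncard = S.ncard + B.ncard := by
  rw [Set.ncard_union_eq _ (Set.toFinite _) (Set.toFinite _),
    Set.ncard_image_of_injective _ liftEdge_injective]
  rw [Set.disjoint_left]
  rintro _ ⟨f, -, rfl⟩
  exact hB f

lemma connected_fromEdgeSet_subdivision_iff {S : Set (Sym2 V)} (x y : V) :
    (SimpleGraph.fromEdgeSet
      (liftEdge '' S ∪ {s(Sum.inl x, Sum.inr ()), s(Sum.inl y, Sum.inr ())})).Connected ↔
      (SimpleGraph.fromEdgeSet (insert s(x, y) S)).Connected := by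
  have hmem : ∀ u v : V, s(Sum.inl u, Sum.inl v) ∈ liftEdge '' S ↔ s(u, v) ∈ S := fun u v =>
    liftEdge_injective.mem_set_image (a := s(u, v))
  have hnew : ∀ a : V ⊕ Unit, s(a, Sum.inr ()) ∉ liftEdge '' S := by
    rintro a ⟨f, -, hf⟩
    exact liftEdge_ne f a hf
  constructor
  · intro h
    refine @SimpleGraph.Connected.mk _ _ (fun u v => ?_) ⟨x⟩
    refine (h.preconnected (Sum.inl u) (Sum.inl v)).of_forall_adj
      (φ := Sum.elim id fun _ => x) ?_
    have hxy : (SimpleGraph.fromEdgeSet (insert s(x, y) S)).Reachable y x := by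
      by_cases hne : y = x
      · rw [hne]
      · exact SimpleGraph.Adj.reachable (by simp [Sym2.eq_swap, hne])
    have hend : ∀ a : V, (SimpleGraph.fromEdgeSet
        (liftEdge '' S ∪ {s(Sum.inl x, Sum.inr ()), s(Sum.inl y, Sum.inr ())})).Adj
          (Sum.inl a) (Sum.inr ()) →
        (SimpleGraph.fromEdgeSet (insert s(x, y) S)).Reachable a x := by
      intro a ha
      have : a = x ∨ a = y := by simpa [hnew] using ha
      obtain rfl | rfl := this
      · exact .refl _
      · exact hxy
    rintro (a | ⟨⟩) (b | ⟨⟩) hab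
    · refine SimpleGraph.Adj.reachable ?_
      have : s(a, b) ∈ S ∧ a ≠ b := by simpa [hmem] using hab
      exact ⟨Or.inr this.1, this.2⟩
    · exact hend a hab
    · exact (hend b hab.symm).symm
    · exact .refl _
  · intro h
    set H := SimpleGraph.fromEdgeSet
      (liftEdge '' S ∪ {s(Sum.inl x, Sum.inr ()), s(Sum.inl y, Sum.inr ())}) with hH
    have hx : H.Reachable (Sum.inl x) (Sum.inr ()) :=
      SimpleGraph.Adj.reachable (by simp [hH])
    have hy : H.Reachable (Sum.inl y) (Sum.inr ()) :=
      SimpleGraph.Adj.reachable (by simp [hH])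
    have hold : ∀ u v : V, H.Reachable (Sum.inl u) (Sum.inl v) := by
      intro u v
      refine (h.preconnected u v).of_forall_adj fun a b hab => ?_
      obtain ⟨hab | hab, hne⟩ := (SimpleGraph.fromEdgeSet_adj _).1 hab
      · obtain ⟨rfl, rfl⟩ | ⟨rfl, rfl⟩ := Sym2.eq_iff.1 hab
        · exact hx.trans hy.symm
        · exact hy.trans hx.symm
      · exact SimpleGraph.Adj.reachable ⟨Or.inl ((hmem a b).2 hab), by simpa using hne⟩
    have hall : ∀ a, H.Reachable a (Sum.inr ()) := by
      rintro (a | ⟨⟩)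
      · exact (hold a x).trans hx
      · exact .refl _
    exact ⟨fun a b => (hall a).trans (hall b).symm⟩

lemma connected_fromEdgeSet_pendant_iff {S : Set (Sym2 V)} (z : V) :
    (SimpleGraph.fromEdgeSet (liftEdge '' S ∪ {s(Sum.inl z, Sum.inr ())})).Connected ↔
      (SimpleGraph.fromEdgeSet S).Connected := by
  have hloop : SimpleGraph.fromEdgeSet (insert s(z, z) S) = SimpleGraph.fromEdgeSet S := by
    ext a b
    simp only [SimpleGraph.fromEdgeSet_adj, Set.mem_insert_iff, Sym2.eq_iff]
    grind
  rw [← hloop, ← connected_fromEdgeSet_subdivision_iff z z, Set.pair_eq_singleton]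

lemma not_connected_fromEdgeSet_liftEdge_image [Nonempty V] (S : Set (Sym2 V)) :
    ¬ (SimpleGraph.fromEdgeSet (liftEdge '' S)).Connected := by
  intro h
  have : Nontrivial (V ⊕ Unit) :=
    ⟨Sum.inl (Classical.arbitrary V), Sum.inr (), Sum.inl_ne_inr⟩
  obtain ⟨b, hb⟩ := h.preconnected.exists_adj_of_nontrivial (Sum.inr ())
  obtain ⟨⟨f, -, hf⟩, -⟩ := (SimpleGraph.fromEdgeSet_adj _).1 hb.symm
  exact liftEdge_ne f b hf

/-- Activity of `f` is transported along a correspondence of trees that respects exchanges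
between old edges, when the remaining edges of both graphs are too large to matter. -/
lemma sameActivityStatus_of_exchange_iff [Finite V] [LinearOrder (Sym2 V)]
    [LinearOrder (Sym2 (V ⊕ Unit))] {G : SimpleGraph V} {G' : SimpleGraph (V ⊕ Unit)}
    {e : Sym2 V} {N : Set (Sym2 (V ⊕ Unit))}
    (hmax : ∀ f ∈ G.edgeSet, f ≤ e)
    (hG' : G'.edgeSet = liftEdge '' (G.edgeSet \ {e}) ∪ N)
    (hord : ∀ f g : Sym2 V, f ∈ G.edgeSet → g ∈ G.edgeSet → f ≠ e → g ≠ e →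
      (f ≤ g ↔ liftEdge f ≤ liftEdge g))
    (hN : ∀ f ∈ G.edgeSet, f ≠ e → ∀ a ∈ N, liftEdge f ≤ a)
    {S : Set (Sym2 V)} {S' : Set (Sym2 (V ⊕ Unit))}
    (hS : IsSpanningTree G S) (hS' : IsSpanningTree G' S')
    (hmem : ∀ f ∈ G.edgeSet, f ≠ e → (liftEdge f ∈ S' ↔ f ∈ S))
    (hex : ∀ f ∈ G.edgeSet, f ≠ e → ∀ g ∈ G.edgeSet, g ≠ e →
      (IsSpanningTree G' (insert (liftEdge g) (S' \ {liftEdge f})) ↔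
        IsSpanningTree G (insert g (S \ {f}))))
    {f : Sym2 V} (hf : f ∈ G.edgeSet) (hfe : f ≠ e) :
    SameActivityStatus G S f G' S' (liftEdge f) := by
  have hold : ∀ g ∈ G.edgeSet, g ≠ e → liftEdge g ∈ G'.edgeSet := fun g hg hge =>
    hG' ▸ Or.inl ⟨g, ⟨hg, hge⟩, rfl⟩
  have hint : InternallyActive G S f ↔ InternallyActive G' S' (liftEdge f) := by
    refine and_congr (hmem f hf hfe).symm ⟨fun h a ha hST => ?_, fun h g hg hST => ?_⟩
    · obtain ⟨g, ⟨hg, hge⟩, rfl⟩ | ha := hG' ▸ ha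
      · exact (hord f g hf hg hfe hge).1 (h g hg ((hex f hf hfe g hg hge).1 hST))
      · exact hN f hf hfe a ha
    · by_cases hge : g = e
      · exact hge ▸ hmax f hf
      · exact (hord f g hf hg hfe hge).2
          (h _ (hold g hg hge) ((hex f hf hfe g hg hge).2 hST))
  have hext : ExternallyActive G S f ↔ ExternallyActive G' S' (liftEdge f) := by
    rw [hS.externallyActive_iff, hS'.externallyActive_iff]
    refine and_congr (iff_of_true hf (hold f hf hfe)) (and_congr
      (not_congr (hmem f hf hfe).symm) ⟨fun h a ha hST => ?_, fun h g hg hST => ?_⟩)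
    · obtain ⟨g, ⟨hg, hge⟩, rfl⟩ | haN := hG' ▸ hS'.1 ha
      · exact (hord f g hf hg hfe hge).1
          (h g ((hmem g hg hge).1 ha) ((hex g hg hge f hf hfe).1 hST))
      · exact hN f hf hfe a haN
    · have hgG := hS.1 hg
      by_cases hge : g = e
      · exact hge ▸ hmax f hf
      · exact (hord f g hf hgG hfe hge).2
          (h _ ((hmem g hgG hge).2 hg) ((hex g hgG hge f hf hfe).2 hST))
  exact ⟨hint, and_congr (hmem f hf hfe).symm (not_congr hint), hext,
    and_congr (iff_of_true hf (hold f hf hfe))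
      (and_congr (not_congr (hmem f hf hfe).symm) (not_congr hext))⟩

lemma isSpanningTree_pendant_iff [Finite V] {G : SimpleGraph V} {G' : SimpleGraph (V ⊕ Unit)}
    {S : Set (Sym2 V)} {z : V} (hS : S ⊆ G.edgeSet)
    (hS' : liftEdge '' S ∪ {s(Sum.inl z, Sum.inr ())} ⊆ G'.edgeSet) :
    IsSpanningTree G' (liftEdge '' S ∪ {s(Sum.inl z, Sum.inr ())}) ↔ IsSpanningTree G S := by
  rw [isSpanningTree_iff_connected_and_ncard, isSpanningTree_iff_connected_and_ncard,
    connected_fromEdgeSet_pendant_iff, ncard_liftEdge_image_union (fun f => liftEdge_ne f _),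
    Set.ncard_singleton, Nat.card_sum, Nat.card_unique (α := Unit), Nat.add_right_cancel_iff]
  simp only [hS, hS', true_and]

lemma isSpanningTree_subdivision_iff [Finite V] {G : SimpleGraph V}
    {G' : SimpleGraph (V ⊕ Unit)} {S : Set (Sym2 V)} {x y : V} (hxy : s(x, y) ∈ G.edgeSet)
    (hnot : s(x, y) ∉ S) (hS : S ⊆ G.edgeSet)
    (hS' : liftEdge '' S ∪ {s(Sum.inl x, Sum.inr ()), s(Sum.inl y, Sum.inr ())} ⊆ G'.edgeSet) :
    IsSpanningTree G'
      (liftEdge '' S ∪ {s(Sum.inl x, Sum.inr ()), s(Sum.inl y, Sum.inr ())}) ↔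
        IsSpanningTree G (insert s(x, y) S) := by
  have hne : x ≠ y := G.ne_of_adj hxy
  rw [isSpanningTree_iff_connected_and_ncard, isSpanningTree_iff_connected_and_ncard,
    connected_fromEdgeSet_subdivision_iff, ncard_liftEdge_image_union
      (by rintro f (h | h) <;> exact liftEdge_ne f _ h),
    Set.ncard_pair (by simpa using hne), Set.ncard_insert_of_notMem hnot (Set.toFinite S),
    Nat.card_sum, Nat.card_unique (α := Unit)]
  simp only [Set.insert_subset hxy hS, hS', true_and]
  refine and_congr_right fun _ => ?_
  omega

end Subdivision

/-- Subdividing the maximum, non-bridge edge `e = s(x, y)` of `G`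
with a new vertex (the unique element of `Unit`), producing the two new edges
`e₁ = s(inl x, inr ())` and `e₂ = s(inl y, inr ())`, where the edge order on the new
graph `G'` extends that of `G \ {e}` and `e₁ < e₂` are the two largest edges:
the spanning trees of `G'` are exactly the three displayed families, activity of all
old edges is preserved, and the new edges have the displayed activity statuses. -/
theorem subdivision_spanning_trees_and_activity
    {V : Type*} [Fintype V] [DecidableEq V]
    [LinearOrder (Sym2 V)] [LinearOrder (Sym2 (V ⊕ Unit))]
    (G : SimpleGraph V) (hG : G.Connected)
    (x y : V) (e : Sym2 V) (hxy : e = s(x, y)) (he : e ∈ G.edgeSet)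
    (hmax : ∀ f ∈ G.edgeSet, f ≤ e)
    (hnotbridge : (G.deleteEdges {e}).Connected)
    (e₁ e₂ : Sym2 (V ⊕ Unit))
    (he₁ : e₁ = s(Sum.inl x, Sum.inr ()))
    (he₂ : e₂ = s(Sum.inl y, Sum.inr ()))
    (G' : SimpleGraph (V ⊕ Unit))
    (hG' : G' = SimpleGraph.fromEdgeSet
      ((liftEdge '' (G.edgeSet \ {e})) ∪ {e₁, e₂}))
    (hord1 : ∀ f g : Sym2 V, f ∈ G.edgeSet → g ∈ G.edgeSet → f ≠ e → g ≠ e →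
      (f ≤ g ↔ liftEdge f ≤ liftEdge g))
    (hord2 : ∀ f ∈ G.edgeSet, f ≠ e → liftEdge f < e₁)
    (hord3 : e₁ < e₂) :
    -- the spanning trees of `G'` are exactly the three displayed families
    (∀ S' : Set (Sym2 (V ⊕ Unit)),
      IsSpanningTree G' S' ↔
        ((∃ S, IsSpanningTree G S ∧ e ∈ S ∧
            S' = liftEdge '' (S \ {e}) ∪ {e₁, e₂}) ∨
          (∃ S, IsSpanningTree G S ∧ e ∉ S ∧ S' = liftEdge '' S ∪ {e₂}) ∨
          (∃ S, IsSpanningTree G S ∧ e ∉ S ∧ S' = liftEdge '' S ∪ {e₁}))) ∧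
    -- case (i): trees containing `e`
    (∀ S : Set (Sym2 V), IsSpanningTree G S → e ∈ S →
      (∀ f ∈ G.edgeSet, f ≠ e →
        SameActivityStatus G S f
          G' (liftEdge '' (S \ {e}) ∪ {e₁, e₂}) (liftEdge f)) ∧
      InternallyInactive G' (liftEdge '' (S \ {e}) ∪ {e₁, e₂}) e₁ ∧
      InternallyInactive G' (liftEdge '' (S \ {e}) ∪ {e₁, e₂}) e₂) ∧
    -- cases (ii) and (iii): trees not containing `e`
    (∀ S : Set (Sym2 V), IsSpanningTree G S → e ∉ S →
      (∀ f ∈ G.edgeSet, f ≠ e →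
        SameActivityStatus G S f
          G' (liftEdge '' S ∪ {e₂}) (liftEdge f) ∧
        SameActivityStatus G S f
          G' (liftEdge '' S ∪ {e₁}) (liftEdge f)) ∧
      (ExternallyInactive G' (liftEdge '' S ∪ {e₂}) e₁ ∧
        InternallyInactive G' (liftEdge '' S ∪ {e₂}) e₂) ∧
      (InternallyActive G' (liftEdge '' S ∪ {e₁}) e₁ ∧
        ExternallyInactive G' (liftEdge '' S ∪ {e₁}) e₂)) := by
  have hdisj : ∀ f B, B ⊆ ({e₁, e₂} : Set (Sym2 (V ⊕ Unit))) → liftEdge f ∉ B := by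
    subst he₁ he₂
    intro f B hB hf
    obtain h | h := hB hf <;> exact liftEdge_ne f _ h
  have hE : G'.edgeSet = liftEdge '' (G.edgeSet \ {e}) ∪ {e₁, e₂} := by
    rw [hG', SimpleGraph.edgeSet_fromEdgeSet, sdiff_eq_left, Set.disjoint_left]
    rintro _ (⟨f, ⟨hf, -⟩, rfl⟩ | rfl | rfl) hd
    · rw [Sym2.mem_diagSet, liftEdge, Sym2.isDiag_map Sum.inl_injective] at hd
      exact G.not_isDiag_of_mem_edgeSet hf hd
    · simp [he₁] at hd
    · simp [he₂] at hd
  have h1E : e₁ ∈ G'.edgeSet := by simp [hE]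
  have h2E : e₂ ∈ G'.edgeSet := by simp [hE]
  have hnew : ∀ f ∈ G.edgeSet, f ≠ e → ∀ a ∈ ({e₁, e₂} : Set (Sym2 (V ⊕ Unit))),
      liftEdge f ≤ a := by
    rintro f hf hfe a (rfl | rfl)
    · exact (hord2 f hf hfe).le
    · exact ((hord2 f hf hfe).trans hord3).le
  have hsub : ∀ S ⊆ G.edgeSet \ {e}, ∀ B ⊆ ({e₁, e₂} : Set (Sym2 (V ⊕ Unit))),
      liftEdge '' S ∪ B ⊆ G'.edgeSet := fun S hS B hB =>
    hE ▸ Set.union_subset_union (Set.image_mono hS) hB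
  have hB1 : {e₁} ⊆ ({e₁, e₂} : Set (Sym2 (V ⊕ Unit))) := by simp
  have hB2 : {e₂} ⊆ ({e₁, e₂} : Set (Sym2 (V ⊕ Unit))) := by simp
  have hT1 : ∀ S ⊆ G.edgeSet \ {e},
      (IsSpanningTree G' (liftEdge '' S ∪ {e₁}) ↔ IsSpanningTree G S) := by
    intro S hS
    have := hsub S hS _ hB1
    subst he₁
    exact isSpanningTree_pendant_iff (hS.trans Set.sdiff_subset) this
  have hT2 : ∀ S ⊆ G.edgeSet \ {e},
      (IsSpanningTree G' (liftEdge '' S ∪ {e₂}) ↔ IsSpanningTree G S) := by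
    intro S hS
    have := hsub S hS _ hB2
    subst he₂
    exact isSpanningTree_pendant_iff (hS.trans Set.sdiff_subset) this
  have hT12 : ∀ S ⊆ G.edgeSet \ {e},
      (IsSpanningTree G' (liftEdge '' S ∪ {e₁, e₂}) ↔ IsSpanningTree G (insert e S)) := by
    intro S hS
    have := hsub S hS _ subset_rfl
    subst he₁ he₂ hxy
    exact isSpanningTree_subdivision_iff he (fun h => (hS h).2 rfl)
      (hS.trans Set.sdiff_subset) this
  have hT0 : ∀ S, ¬ IsSpanningTree G' (liftEdge '' S) := fun S h =>
    @not_connected_fromEdgeSet_liftEdge_image _ ⟨x⟩ S h.2.connected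
  have hmem_of : ∀ S ⊆ G.edgeSet, e ∉ S → S ⊆ G.edgeSet \ {e} := fun S hS heS f hf =>
    ⟨hS hf, fun h => heS (h ▸ hf)⟩
  have hexch : ∀ S ⊆ G.edgeSet \ {e}, ∀ f, ∀ g ∈ G.edgeSet, g ≠ e →
      insert g (S \ {f}) ⊆ G.edgeSet \ {e} := fun S hS f g hg hge =>
    Set.insert_subset ⟨hg, hge⟩ (Set.sdiff_subset.trans hS)
  refine ⟨fun S' => ⟨fun hS' => ?_, ?_⟩, fun S hS heS => ?_, fun S hS heS => ?_⟩
  · set S₀ := liftEdge ⁻¹' S' with hS₀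
    have hS₀sub : S₀ ⊆ G.edgeSet \ {e} := by
      intro f hf
      obtain ⟨g, hg, hgf⟩ | h := hE ▸ hS'.1 hf
      · exact liftEdge_injective hgf ▸ hg
      · exact absurd h (hdisj f _ subset_rfl)
    have heS₀ : e ∉ S₀ := fun h => (hS₀sub h).2 rfl
    have hdecomp : ∀ B ⊆ ({e₁, e₂} : Set (Sym2 (V ⊕ Unit))), (e₁ ∈ S' ↔ e₁ ∈ B) →
        (e₂ ∈ S' ↔ e₂ ∈ B) → S' = liftEdge '' S₀ ∪ B := by
      intro B hB h1 h2
      ext a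
      constructor
      · intro ha
        obtain ⟨g, hg, rfl⟩ | rfl | rfl := hE ▸ hS'.1 ha
        · exact Or.inl ⟨g, ha, rfl⟩
        · exact Or.inr (h1.1 ha)
        · exact Or.inr (h2.1 ha)
      · rintro (⟨g, hg, rfl⟩ | ha)
        · exact hg
        · obtain rfl | rfl := hB ha
          · exact h1.2 ha
          · exact h2.2 ha
    by_cases h1 : e₁ ∈ S' <;> by_cases h2 : e₂ ∈ S'
    · have h := hdecomp _ subset_rfl (by simp [h1]) (by simp [h2])
      refine Or.inl ⟨insert e S₀, (hT12 S₀ hS₀sub).1 (h ▸ hS'), Set.mem_insert _ _, ?_⟩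
      rw [Set.insert_sdiff_self_of_notMem heS₀]
      exact h
    · have h := hdecomp _ hB1 (by simp [h1]) (by simp [h2, hord3.ne'])
      exact Or.inr (Or.inr ⟨S₀, (hT1 S₀ hS₀sub).1 (h ▸ hS'), heS₀, h⟩)
    · have h := hdecomp _ hB2 (by simp [h1, hord3.ne]) (by simp [h2])
      exact Or.inr (Or.inl ⟨S₀, (hT2 S₀ hS₀sub).1 (h ▸ hS'), heS₀, h⟩)
    · have h := hdecomp ∅ (Set.empty_subset _) (by simp [h1]) (by simp [h2])
      rw [Set.union_empty] at h
      exact absurd (h ▸ hS') (hT0 S₀)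
  · rintro (⟨S, hS, heS, rfl⟩ | ⟨S, hS, heS, rfl⟩ | ⟨S, hS, heS, rfl⟩)
    · rw [hT12 _ (Set.sdiff_subset_sdiff_left hS.1), Set.insert_sdiff_self_of_mem heS]
      exact hS
    · exact (hT2 S (hmem_of S hS.1 heS)).2 hS
    · exact (hT1 S (hmem_of S hS.1 heS)).2 hS
  · have hS₀ : S \ {e} ⊆ G.edgeSet \ {e} := Set.sdiff_subset_sdiff_left hS.1
    have hS' : IsSpanningTree G' (liftEdge '' (S \ {e}) ∪ {e₁, e₂}) := by
      rw [hT12 _ hS₀, Set.insert_sdiff_self_of_mem heS]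
      exact hS
    obtain ⟨g, hg, hgS, hgT⟩ := hS.exists_exchange_of_mem heS hnotbridge
    have hge : g ≠ e := fun h => hgS (h ▸ heS)
    have hgsub : insert g (S \ {e}) ⊆ G.edgeSet \ {e} := Set.insert_subset ⟨hg, hge⟩ hS₀
    have hgG' : liftEdge g ∈ G'.edgeSet := hE ▸ Or.inl ⟨g, ⟨hg, hge⟩, rfl⟩
    have hn1 : e₁ ∉ liftEdge '' (S \ {e}) := by
      rintro ⟨f, -, hf⟩; exact hdisj f _ hB1 hf
    have hn2 : e₂ ∉ liftEdge '' (S \ {e}) := by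
      rintro ⟨f, -, hf⟩; exact hdisj f _ hB2 hf
    refine ⟨fun f hf hfe => ?_, ⟨by simp, fun h => ?_⟩, by simp, fun h => ?_⟩
    · refine sameActivityStatus_of_exchange_iff hmax hE hord1 hnew hS hS' ?_ ?_ hf hfe
      · intro f hf hfe
        rw [liftEdge_mem_image_union_iff (hdisj f _ subset_rfl)]
        simp [hfe]
      · intro f hf hfe g hg hge
        rw [liftEdge_image_insert_sdiff_union (hdisj f _ subset_rfl),
          hT12 _ (hexch _ hS₀ f g hg hge)]
        have : insert e (insert g ((S \ {e}) \ {f})) = insert g (S \ {f}) := by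
          ext a
          simp only [Set.mem_insert_iff, Set.mem_sdiff, Set.mem_singleton_iff]
          grind
        rw [this]
    · have heq : insert (liftEdge g) ((liftEdge '' (S \ {e}) ∪ {e₁, e₂}) \ {e₁}) =
          liftEdge '' insert g (S \ {e}) ∪ {e₂} := by
        have := hord3.ne
        ext a
        simp only [Set.image_insert_eq, Set.mem_insert_iff, Set.mem_sdiff, Set.mem_union,
          Set.mem_singleton_iff]
        grind
      have := h.2 _ hgG' (heq ▸ (hT2 _ hgsub).2 hgT)
      exact this.not_gt (hord2 g hg hge)
    · have heq : insert (liftEdge g) ((liftEdge '' (S \ {e}) ∪ {e₁, e₂}) \ {e₂}) =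
          liftEdge '' insert g (S \ {e}) ∪ {e₁} := by
        have := hord3.ne
        ext a
        simp only [Set.image_insert_eq, Set.mem_insert_iff, Set.mem_sdiff, Set.mem_union,
          Set.mem_singleton_iff]
        grind
      have := h.2 _ hgG' (heq ▸ (hT1 _ hgsub).2 hgT)
      exact this.not_gt ((hord2 g hg hge).trans hord3)
  · have hS₀ : S ⊆ G.edgeSet \ {e} := hmem_of S hS.1 heS
    have hS1 := (hT1 S hS₀).2 hS
    have hS2 := (hT2 S hS₀).2 hS
    have hn1 : e₁ ∉ liftEdge '' S := by
      rintro ⟨f, -, hf⟩; exact hdisj f _ hB1 hf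
    have hn2 : e₂ ∉ liftEdge '' S := by
      rintro ⟨f, -, hf⟩; exact hdisj f _ hB2 hf
    have hn1' : e₁ ∉ liftEdge '' S ∪ {e₂} := by simp [hn1, hord3.ne]
    have hn2' : e₂ ∉ liftEdge '' S ∪ {e₁} := by simp [hn2, hord3.ne']
    have hswap : ∀ a b, a ∉ liftEdge '' S →
        insert b ((liftEdge '' S ∪ {a}) \ {a}) = liftEdge '' S ∪ {b} := by
      intro a b ha
      rw [Set.union_sdiff_right, Set.sdiff_singleton_eq_self ha, Set.union_singleton]
    obtain ⟨g, hgS, hgT⟩ := hS.exists_exchange_of_notMem he heS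
    have hgG : g ∈ G.edgeSet := hS.1 hgS
    have hge : g ≠ e := fun h => heS (h ▸ hgS)
    have hsdiff : S \ {g} ⊆ G.edgeSet \ {e} := Set.sdiff_subset.trans hS₀
    have hgT' := (hT12 _ hsdiff).2 hgT
    have hcyc : ∀ a b, ({b, a} : Set (Sym2 (V ⊕ Unit))) = {e₁, e₂} →
        IsSpanningTree G' (insert b ((liftEdge '' S ∪ {a}) \ {liftEdge g})) := by
      intro a b hab
      have ha : liftEdge g ∉ ({a} : Set (Sym2 (V ⊕ Unit))) := hdisj g _ (by simp [← hab])
      rw [Set.union_sdiff_distrib, Set.sdiff_singleton_eq_self ha, ← Set.image_singleton,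
        ← Set.image_sdiff liftEdge_injective, ← Set.union_insert, hab]
      exact hgT'
    refine ⟨fun f hf hfe => ⟨?_, ?_⟩, ⟨⟨h1E, hn1', fun h => ?_⟩, by simp, fun h => ?_⟩,
      ⟨by simp, fun a ha hST => ?_⟩, h2E, hn2', fun h => ?_⟩
    · refine sameActivityStatus_of_exchange_iff hmax hE hord1 hnew hS hS2 ?_ ?_ hf hfe
      · exact fun f _ _ => liftEdge_mem_image_union_iff (hdisj f _ hB2)
      · intro f hf hfe g hg hge
        rw [liftEdge_image_insert_sdiff_union (hdisj f _ hB2), hT2 _ (hexch S hS₀ f g hg hge)]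
    · refine sameActivityStatus_of_exchange_iff hmax hE hord1 hnew hS hS1 ?_ ?_ hf hfe
      · exact fun f _ _ => liftEdge_mem_image_union_iff (hdisj f _ hB1)
      · intro f hf hfe g hg hge
        rw [liftEdge_image_insert_sdiff_union (hdisj f _ hB1), hT1 _ (hexch S hS₀ f g hg hge)]
    · have := (hS2.externallyActive_iff.1 h).2.2 _ (Or.inl ⟨g, hgS, rfl⟩) (hcyc _ _ rfl)
      exact this.not_gt (hord2 g hgG hge)
    · have := h.2 e₁ h1E ((hswap e₂ e₁ hn2).symm ▸ hS1)
      exact this.not_gt hord3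
    · rw [hswap _ _ hn1] at hST
      obtain ⟨f, hf, rfl⟩ | rfl | rfl := hE ▸ ha
      · rw [Set.union_singleton, ← Set.image_insert_eq] at hST
        exact absurd hST (hT0 _)
      · exact le_rfl
      · exact hord3.le
    · have := (hS1.externallyActive_iff.1 h).2.2 _ (Or.inl ⟨g, hgS, rfl⟩)
        (hcyc _ _ (Set.pair_comm _ _))
      exact this.not_gt ((hord2 g hgG hge).trans hord3)
end
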